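/- arXiv:2404.13942 — 3 statements merged into one kernel-verified Lean document; each statement's English description precedes it below -/
import Mathlib

section
/- (Adiprasito–Huh–Katz; conjectured by Heron, Rota, and Welsh) Let M be a loopless matroid of rank r on a finite ground set E, with rank function r(·), and write its characteristic polynomial as χ_M(λ) = Σ_{I ⊆ E} (−1)^{|I|} λ^{r(E) − r(I)} = Σ_{k=0}^{r} (−1)^k w_k λ^{r−k}. Then each w_k is nonnegative and the sequence (w_0, w_1, …, w_r) is log-concave: w_k² ≥ w_{k−1} · w_{k+1} for all 1 ≤ k ≤ r−1. -/
/-- The rank of the set `A` in the matroid `M`: the maximum cardinality of an independent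
subset of `A`. -/
noncomputable def matroidRank {α : Type*} (M : Matroid α) (A : Set α) : ℕ :=
  sSup {n : ℕ | ∃ I : Set α, I ⊆ A ∧ M.Indep I ∧ I.ncard = n}

/-- A ranked poset of point sets in which, for `A < B`, every point of `B` outside `A` lies in
exactly one element of rank `rk A + 1` between `A` and `B`. Lattices of flats of matroids are
the motivating examples. -/
structure FlatSystem (P E : Type*) [PartialOrder P] where
  /-- the set of points of an element -/
  pts : P → Finset E
  /-- the rank of an element -/
  rk : P → ℕ
  le_iff : ∀ {A B : P}, A ≤ B ↔ pts A ⊆ pts B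
  rk_lt : ∀ {A B : P}, A < B → rk A < rk B
  existsUnique_cover : ∀ {A B : P} {i : E}, A < B → i ∈ pts B → i ∉ pts A →
    ∃! F, A < F ∧ F ≤ B ∧ i ∈ pts F ∧ rk F = rk A + 1

namespace FlatSystem

open scoped Classical

variable {P E R : Type*} [PartialOrder P]

lemma not_between {A B : P} (h : ¬ A < B) (F : P) : ¬ (A < F ∧ F < B) :=
  fun hF => h (hF.1.trans hF.2)

variable (G : FlatSystem P E) [CommRing R]

lemma mem_of_le {A B : P} (h : A ≤ B) {i : E} (hi : i ∈ G.pts A) : i ∈ G.pts B :=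
  G.le_iff.1 h hi

lemma exists_mem_notMem {A B : P} (h : A < B) : ∃ i, i ∈ G.pts B ∧ i ∉ G.pts A := by
  by_contra! hc
  exact h.not_ge (G.le_iff.2 fun i hi => hc i hi)

variable (R) in
/-- The indicator function of the elements containing the point `i`. -/
noncomputable def ind (i : E) (F : P) : R := if i ∈ G.pts F then 1 else 0

lemma ind_of_mem {i : E} {F : P} (h : i ∈ G.pts F) : G.ind R i F = 1 := if_pos h

lemma ind_of_notMem {i : E} {F : P} (h : i ∉ G.pts F) : G.ind R i F = 0 := if_neg h

variable (R) in
/-- The indicator function of a chosen point of `B` outside `A`. -/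
noncomputable def chi (A B F : P) : R :=
  if h : ∃ i, i ∈ G.pts B ∧ i ∉ G.pts A then G.ind R h.choose F else 0

lemma exists_chi {A B : P} (h : A < B) :
    ∃ i, i ∈ G.pts B ∧ i ∉ G.pts A ∧ ∀ F, G.chi R A B F = G.ind R i F := by
  have h' := G.exists_mem_notMem h
  exact ⟨h'.choose, h'.choose_spec.1, h'.choose_spec.2, fun F => dif_pos h'⟩

/-- The function `u`, modified by a modular function so as to vanish at `A` and `B`. -/
noncomputable def nrm (u : P → R) (A B F : P) : R :=
  u F - u A - (u B - u A) * G.chi R A B F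

lemma nrm_left {A B : P} (h : A < B) (u : P → R) : G.nrm u A B A = 0 := by
  obtain ⟨i, -, hA, hi⟩ := G.exists_chi (R := R) h
  simp [nrm, hi, G.ind_of_notMem hA]

lemma nrm_right {A B : P} (h : A < B) (u : P → R) : G.nrm u A B B = 0 := by
  obtain ⟨i, hB, -, hi⟩ := G.exists_chi (R := R) h
  simp [nrm, hi, G.ind_of_mem hB]

lemma nrm_eq_self {A B : P} {u : P → R} (hA : u A = 0) (hB : u B = 0) : G.nrm u A B = u := by
  funext F
  simp [nrm, hA, hB]

/-- The degree of the volume polynomial of `[A, B]`. -/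
noncomputable def deg (A B : P) : ℝ := (G.rk B : ℝ) - G.rk A - 1

lemma deg_add_deg (A F B : P) : G.deg A F + G.deg F B = G.deg A B - 1 := by
  simp only [deg]; ring

variable [Fintype P] [Algebra ℝ R] (t : P → R)

/-- The volume polynomial of the interval `[A, B]`, evaluated at `t`. -/
noncomputable def vol (A B : P) : R :=
  if A < B then
    if G.rk B = G.rk A + 1 then 1
    else ((G.rk B : ℝ) - G.rk A - 1)⁻¹ •
      ∑ F, if _h : A < F ∧ F < B then G.nrm t A B F * (vol A F * vol F B) else 0
  else 0
termination_by G.rk B - G.rk A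
decreasing_by
  · have h1 := G.rk_lt _h.1
    have h2 := G.rk_lt _h.2
    omega
  · have h1 := G.rk_lt _h.1
    have h2 := G.rk_lt _h.2
    omega

lemma vol_of_not_lt {A B : P} (h : ¬ A < B) : G.vol t A B = 0 := by
  rw [vol, if_neg h]

lemma vol_of_cover {A B : P} (h : A < B) (hr : G.rk B = G.rk A + 1) : G.vol t A B = 1 := by
  rw [vol, if_pos h, if_pos hr]

lemma vol_mul_vol_eq_zero {A B F : P} (h : ¬ (A < F ∧ F < B)) :
    G.vol t A F * G.vol t F B = 0 := by
  by_cases h1 : A < F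
  · rw [G.vol_of_not_lt t fun h2 => h ⟨h1, h2⟩, mul_zero]
  · rw [G.vol_of_not_lt t h1, zero_mul]

/-- The derivative of the volume polynomial of `[A, B]` at `t` in direction `u`. -/
noncomputable def dvol (u : P → R) (A B : P) : R :=
  ∑ F, G.nrm u A B F * (G.vol t A F * G.vol t F B)

/-- The derivative in direction `v` of `vol t A F * vol t F B`. -/
noncomputable def dpair (v : P → R) (A F B : P) : R :=
  G.dvol t v A F * G.vol t F B + G.vol t A F * G.dvol t v F B

/-- The second derivative of the volume polynomial of `[A, B]` at `t`. -/
noncomputable def hess (u v : P → R) (A B : P) : R :=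
  ∑ F, G.nrm u A B F * G.dpair t v A F B

/-- The derivative of the volume polynomial in the direction `- 1_B`. -/
noncomputable def svol (A B : P) : R := ∑ F, G.chi R A B F * (G.vol t A F * G.vol t F B)

/-- The derivative of the volume polynomial in the direction `- 1_A`. -/
noncomputable def pvol (A B : P) : R := ∑ F, (1 - G.chi R A B F) * (G.vol t A F * G.vol t F B)

lemma dvol_of_rk_le {A B : P} (h : G.rk B ≤ G.rk A + 1) (u : P → R) : G.dvol t u A B = 0 := by
  refine Finset.sum_eq_zero fun F _ => ?_
  rw [vol_mul_vol_eq_zero, mul_zero]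
  rintro ⟨h1, h2⟩
  have := G.rk_lt h1
  have := G.rk_lt h2
  omega

lemma deg_smul_vol (A B : P) : G.deg A B • G.vol t A B = G.dvol t t A B := by
  by_cases h : A < B
  · by_cases hr : G.rk B = G.rk A + 1
    · rw [G.dvol_of_rk_le t hr.le, deg, hr]
      simp
    · rw [vol, if_pos h, if_neg hr, deg, smul_smul, mul_inv_cancel₀, one_smul, dvol]
      · refine Finset.sum_congr rfl fun F _ => ?_
        split_ifs with hF
        · rfl
        · rw [G.vol_mul_vol_eq_zero t hF, mul_zero]
      · have := G.rk_lt h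
        intro h0
        apply hr
        have : (G.rk B : ℝ) = G.rk A + 1 := by linarith
        exact_mod_cast this
  · rw [G.vol_of_not_lt t h, smul_zero, dvol]
    refine (Finset.sum_eq_zero fun F _ => ?_).symm
    rw [vol_mul_vol_eq_zero _ _ (not_between h F), mul_zero]

lemma dpair_self (A F B : P) :
    G.dpair t t A F B = (G.deg A B - 1) • (G.vol t A F * G.vol t F B) := by
  rw [dpair, ← deg_smul_vol, ← deg_smul_vol, ← deg_add_deg G A F B, add_smul,
    smul_mul_assoc, mul_smul_comm]

lemma dpair_eq_zero (u : P → R) {A F B : P} (h : ¬ (A < F ∧ F < B)) :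
    G.dpair t u A F B = 0 := by
  have key : ∀ X Y, ¬ X < Y → G.dvol t u X Y = 0 := fun X Y hXY => by
    refine Finset.sum_eq_zero fun F _ => ?_
    rw [vol_mul_vol_eq_zero _ _ (not_between hXY F), mul_zero]
  rw [dpair]
  by_cases h1 : A < F
  · rw [G.vol_of_not_lt t fun h2 => h ⟨h1, h2⟩, key F B fun h2 => h ⟨h1, h2⟩]
    ring
  · rw [G.vol_of_not_lt t h1, key A F h1]
    ring

/-- The linear relation in the interval `[A, B]`. -/
def Inv (A B : P) : Prop :=
  ∀ i ∈ G.pts B, i ∉ G.pts A →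
    ∑ F, G.ind R i F * (G.vol t A F * G.vol t F B) = G.svol t A B

variable {t} in
lemma sum_ind_mul {A B : P} (h : G.Inv t A B) {i : E} (hA : i ∉ G.pts A) :
    ∑ F, G.ind R i F * (G.vol t A F * G.vol t F B) = G.ind R i B * G.svol t A B := by
  by_cases hB : i ∈ G.pts B
  · rw [h i hB hA, G.ind_of_mem hB, one_mul]
  · rw [G.ind_of_notMem hB, zero_mul]
    refine Finset.sum_eq_zero fun F _ => ?_
    by_cases hF : A < F ∧ F < B
    · rw [G.ind_of_notMem fun hi => hB (G.mem_of_le hF.2.le hi), zero_mul]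
    · rw [G.vol_mul_vol_eq_zero t hF, mul_zero]

lemma pvol_add_svol (A B : P) :
    G.pvol t A B + G.svol t A B = ∑ F, G.vol t A F * G.vol t F B := by
  rw [pvol, svol, ← Finset.sum_add_distrib]
  exact Finset.sum_congr rfl fun F _ => by ring

variable {t} in
lemma sum_one_sub_ind_mul {A B : P} (h : G.Inv t A B) {i : E} (hB : i ∈ G.pts B) :
    ∑ F, (1 - G.ind R i F) * (G.vol t A F * G.vol t F B) =
      (1 - G.ind R i A) * G.pvol t A B := by
  by_cases hA : i ∈ G.pts A
  · rw [G.ind_of_mem hA, sub_self, zero_mul]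
    refine Finset.sum_eq_zero fun F _ => ?_
    by_cases hF : A < F ∧ F < B
    · rw [G.ind_of_mem (G.mem_of_le hF.1.le hA), sub_self, zero_mul]
    · rw [G.vol_mul_vol_eq_zero t hF, mul_zero]
  · simp only [sub_mul, one_mul, Finset.sum_sub_distrib]
    rw [h i hB hA, G.ind_of_notMem hA, ← pvol_add_svol]
    ring

lemma dvol_eq (u : P → R) (A B : P) :
    G.dvol t u A B = ∑ F, u F * (G.vol t A F * G.vol t F B) - u A * G.pvol t A B
      - u B * G.svol t A B := by
  rw [dvol, pvol, svol, Finset.mul_sum, Finset.mul_sum, ← Finset.sum_sub_distrib,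
    ← Finset.sum_sub_distrib]
  refine Finset.sum_congr rfl fun F _ => ?_
  rw [nrm]
  ring

lemma dvol_add (u v : P → R) (A B : P) :
    G.dvol t (fun F => u F + v F) A B = G.dvol t u A B + G.dvol t v A B := by
  simp only [dvol, ← Finset.sum_add_distrib]
  exact Finset.sum_congr rfl fun F _ => by simp only [nrm]; ring

lemma dvol_mul (c : R) (u : P → R) (A B : P) :
    G.dvol t (fun F => c * u F) A B = c * G.dvol t u A B := by
  simp only [dvol, Finset.mul_sum]
  exact Finset.sum_congr rfl fun F _ => by simp only [nrm]; ring

lemma dvol_const (c : R) (A B : P) : G.dvol t (fun _ => c) A B = 0 :=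
  Finset.sum_eq_zero fun F _ => by simp [nrm]

lemma dvol_sum {ι : Type*} (K : Finset ι) (u : ι → P → R) (A B : P) :
    G.dvol t (fun F => ∑ e ∈ K, u e F) A B = ∑ e ∈ K, G.dvol t (u e) A B := by
  induction K using Finset.induction_on with
  | empty => simpa using G.dvol_const t 0 A B
  | insert a K ha ih =>
    simp only [Finset.sum_insert ha, dvol_add, ih]

lemma dvol_congr {u v : P → R} {A B : P} (h : ∀ F, A ≤ F → F ≤ B → u F = v F) :
    G.dvol t u A B = G.dvol t v A B := by
  refine Finset.sum_congr rfl fun F _ => ?_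
  by_cases hF : A < F ∧ F < B
  · have hAB := hF.1.le.trans hF.2.le
    simp only [nrm, h F hF.1.le hF.2.le, h A le_rfl hAB, h B hAB le_rfl]
  · rw [G.vol_mul_vol_eq_zero t hF, mul_zero, mul_zero]

variable {t} in
lemma dvol_ind {A B : P} (h : G.Inv t A B) (i : E) : G.dvol t (G.ind R i) A B = 0 := by
  rw [dvol_eq]
  by_cases hA : i ∈ G.pts A
  · by_cases hAB : A < B
    · rw [G.ind_of_mem hA, G.ind_of_mem (G.mem_of_le hAB.le hA), one_mul, one_mul, sub_sub,
        pvol_add_svol, sub_eq_zero]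
      refine Finset.sum_congr rfl fun F _ => ?_
      by_cases hF : A < F ∧ F < B
      · rw [G.ind_of_mem (G.mem_of_le hF.1.le hA), one_mul]
      · rw [G.vol_mul_vol_eq_zero t hF, mul_zero]
    · have := not_between hAB
      simp [pvol, svol, fun F => G.vol_mul_vol_eq_zero t (this F)]
  · rw [G.sum_ind_mul h hA, G.ind_of_notMem hA]
    ring

variable {t} in
lemma dvol_modular {A B : P} (h : G.Inv t A B) {u v : P → R} (c : R) (m : E → R)
    (huv : ∀ F, v F = u F + c + ∑ e ∈ G.pts F, m e) : G.dvol t v A B = G.dvol t u A B := by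
  have h1 : G.dvol t v A B =
      G.dvol t (fun F => (u F + c) + ∑ e ∈ G.pts B, m e * G.ind R e F) A B := by
    refine G.dvol_congr t fun F _ hF => ?_
    rw [huv]
    congr 1
    simp only [ind, mul_ite, mul_one, mul_zero]
    rw [← Finset.sum_filter, Finset.filter_mem_eq_inter,
      Finset.inter_eq_right.2 (G.le_iff.1 hF)]
  rw [h1, dvol_add, dvol_add, dvol_const, dvol_sum]
  simp [dvol_mul, G.dvol_ind h]

variable {t} in
lemma dvol_nrm {A B X Y : P} (hXY : X < Y) (h : G.Inv t A B) (u : P → R) :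
    G.dvol t (G.nrm u X Y) A B = G.dvol t u A B := by
  obtain ⟨i, -, -, hi⟩ := G.exists_chi (R := R) hXY
  have : G.nrm u X Y = fun F => (u F + (- u X)) + (-(u Y - u X)) * G.ind R i F := by
    funext F
    rw [nrm, hi]
    ring
  rw [this, dvol_add, dvol_add, dvol_const, dvol_mul, G.dvol_ind h]
  ring

variable {t} in
lemma dpair_nrm {A F B : P} (hAB : A < B) (h1 : G.Inv t A F) (h2 : G.Inv t F B) (u : P → R) :
    G.dpair t (G.nrm u A B) A F B = G.dpair t u A F B := by
  rw [dpair, dpair, G.dvol_nrm hAB h1, G.dvol_nrm hAB h2]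

lemma sum_dpair {v : P → R} {A B : P} (hA : v A = 0) (hB : v B = 0) (c : P → R) :
    ∑ F, c F * G.dpair t v A F B =
      ∑ F, ∑ K, c F * v K * (G.vol t A K * G.vol t K F * G.vol t F B
        + G.vol t A F * G.vol t F K * G.vol t K B)
      - ∑ F, c F * v F * (G.svol t A F * G.vol t F B + G.vol t A F * G.pvol t F B) := by
  rw [← Finset.sum_sub_distrib]
  refine Finset.sum_congr rfl fun F _ => ?_
  rw [dpair, dvol_eq, dvol_eq, hA, hB]
  have : ∑ K, c F * v K * (G.vol t A K * G.vol t K F * G.vol t F B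
        + G.vol t A F * G.vol t F K * G.vol t K B) =
      c F * ((∑ K, v K * (G.vol t A K * G.vol t K F)) * G.vol t F B
        + G.vol t A F * ∑ K, v K * (G.vol t F K * G.vol t K B)) := by
    rw [Finset.sum_mul, Finset.mul_sum, ← Finset.sum_add_distrib, Finset.mul_sum]
    exact Finset.sum_congr rfl fun K _ => by ring
  rw [this]
  ring

lemma sum_ind_mul_of_rk_two {A B : P} (hAB : A < B) (hd : G.rk B = G.rk A + 2) {i : E}
    (hiB : i ∈ G.pts B) (hiA : i ∉ G.pts A) :
    ∑ F, G.ind R i F * (G.vol t A F * G.vol t F B) = 1 := by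
  obtain ⟨F, ⟨hF1, hF2, hF3, hF4⟩, hF5⟩ := G.existsUnique_cover hAB hiB hiA
  have hFB : F < B := lt_of_le_of_ne hF2 fun h => by rw [h] at hF4; omega
  rw [Finset.sum_eq_single F]
  · rw [G.ind_of_mem hF3, G.vol_of_cover t hF1 hF4, G.vol_of_cover t hFB (by omega)]
    ring
  · intro K _ hK
    by_cases hK' : A < K ∧ K < B
    · by_cases hiK : i ∈ G.pts K
      · refine absurd (hF5 K ⟨hK'.1, hK'.2.le, hiK, ?_⟩) hK
        have := G.rk_lt hK'.1
        have := G.rk_lt hK'.2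
        omega
      · rw [G.ind_of_notMem hiK, zero_mul]
    · rw [G.vol_mul_vol_eq_zero t hK', mul_zero]
  · simp

lemma svol_of_rk_two {A B : P} (hAB : A < B) (hd : G.rk B = G.rk A + 2) :
    G.svol t A B = 1 := by
  obtain ⟨j, hjB, hjA, hj⟩ := G.exists_chi (R := R) hAB
  rw [svol, ← G.sum_ind_mul_of_rk_two t hAB hd hjB hjA]
  simp only [hj]

theorem inv_all (A B : P) : G.Inv t A B := by
  induction hn : G.rk B - G.rk A using Nat.strong_induction_on generalizing A B with
  | _ n ih =>
  intro i hiB hiA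
  by_cases hAB : A < B
  swap
  · simp [svol, fun F => G.vol_mul_vol_eq_zero t (not_between hAB F)]
  obtain ⟨j, hjB, hjA, hj⟩ := G.exists_chi (R := R) hAB
  have hlow : ∀ F, A < F → F < B → G.Inv t A F ∧ G.Inv t F B := fun F h1 h2 => by
    have := G.rk_lt h1
    have := G.rk_lt h2
    exact ⟨ih _ (by omega) A F rfl, ih _ (by omega) F B rfl⟩
  by_cases hd : G.rk B = G.rk A + 2
  · rw [G.sum_ind_mul_of_rk_two t hAB hd hiB hiA, G.svol_of_rk_two t hAB hd]
  · rw [svol, ← sub_eq_zero, ← Finset.sum_sub_distrib]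
    simp only [hj, ← sub_mul]
    set m : P → R := fun F => G.ind R i F - G.ind R j F with hm
    have h0 : (G.deg A B - 1) • ∑ F, m F * (G.vol t A F * G.vol t F B) = 0 := by
      have e1 : (G.deg A B - 1) • ∑ F, m F * (G.vol t A F * G.vol t F B) =
          ∑ F, m F * G.dpair t (G.nrm t A B) A F B := by
        rw [Finset.smul_sum]
        refine Finset.sum_congr rfl fun F _ => ?_
        by_cases hF : A < F ∧ F < B
        · rw [G.dpair_nrm hAB (hlow F hF.1 hF.2).1 (hlow F hF.1 hF.2).2, dpair_self,
            mul_smul_comm]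
        · rw [G.vol_mul_vol_eq_zero t hF, G.dpair_eq_zero t _ hF]
          simp
      rw [e1, G.sum_dpair t (G.nrm_left hAB t) (G.nrm_right hAB t), Finset.sum_comm,
        ← Finset.sum_sub_distrib]
      refine Finset.sum_eq_zero fun K _ => ?_
      by_cases hK : A < K ∧ K < B
      · have h1 : ∑ F, m F * (G.vol t A F * G.vol t F K) = m K * G.svol t A K := by
          simp only [hm, sub_mul, Finset.sum_sub_distrib]
          rw [G.sum_ind_mul (hlow K hK.1 hK.2).1 hiA, G.sum_ind_mul (hlow K hK.1 hK.2).1 hjA]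
        have h2 : ∑ F, m F * (G.vol t K F * G.vol t F B) = m K * G.pvol t K B := by
          have e : ∀ F, m F * (G.vol t K F * G.vol t F B) =
              (1 - G.ind R j F) * (G.vol t K F * G.vol t F B)
              - (1 - G.ind R i F) * (G.vol t K F * G.vol t F B) := fun F => by
            simp only [hm]; ring
          rw [Finset.sum_congr rfl fun F _ => e F, Finset.sum_sub_distrib,
            G.sum_one_sub_ind_mul (hlow K hK.1 hK.2).2 hiB,
            G.sum_one_sub_ind_mul (hlow K hK.1 hK.2).2 hjB]
          simp only [hm]
          ring
        have h3 : ∑ F, m F * G.nrm t A B K * (G.vol t A K * G.vol t K F * G.vol t F B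
            + G.vol t A F * G.vol t F K * G.vol t K B) =
            G.nrm t A B K * (G.vol t A K * (∑ F, m F * (G.vol t K F * G.vol t F B))
              + (∑ F, m F * (G.vol t A F * G.vol t F K)) * G.vol t K B) := by
          rw [Finset.sum_mul, Finset.mul_sum, ← Finset.sum_add_distrib, Finset.mul_sum]
          exact Finset.sum_congr rfl fun F _ => by ring
        rw [h3, h1, h2]
        ring
      · have hz : ∀ X Y, ¬ X < Y → G.svol t X Y = 0 ∧ G.pvol t X Y = 0 := fun X Y hXY => by
          simp [svol, pvol, fun F => G.vol_mul_vol_eq_zero t (not_between hXY F)]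
        rw [not_and_or] at hK
        rcases hK with hK | hK
        · have e1 : ∀ F, G.vol t A F * G.vol t F K = 0 := fun F =>
            G.vol_mul_vol_eq_zero t (not_between hK F)
          simp [e1, G.vol_of_not_lt t hK, (hz A K hK).1]
        · have e1 : ∀ F, G.vol t K F * G.vol t F B = 0 := fun F =>
            G.vol_mul_vol_eq_zero t (not_between hK F)
          simp [e1, mul_assoc, G.vol_of_not_lt t hK, (hz K B hK).2]
    by_cases hd1 : G.deg A B - 1 = 0
    · refine absurd ?_ hd
      have : (G.rk B : ℝ) = G.rk A + 2 := by
        simp only [deg] at hd1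
        linarith
      exact_mod_cast this
    · have := congrArg (fun x => (G.deg A B - 1)⁻¹ • x) h0
      simpa only [smul_smul, inv_mul_cancel₀ hd1, one_smul, smul_zero] using this

theorem hess_comm (u v : P → R) (A B : P) : G.hess t u v A B = G.hess t v u A B := by
  by_cases hAB : A < B
  · have key : ∀ u v : P → R, G.hess t u v A B = ∑ F, ∑ K, G.nrm u A B F * G.nrm v A B K *
          (G.vol t A K * G.vol t K F * G.vol t F B + G.vol t A F * G.vol t F K * G.vol t K B)
        - ∑ F, G.nrm u A B F * G.nrm v A B F *
          (G.svol t A F * G.vol t F B + G.vol t A F * G.pvol t F B) := fun u v => by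
      rw [← G.sum_dpair t (G.nrm_left hAB v) (G.nrm_right hAB v), hess]
      exact Finset.sum_congr rfl fun F _ => by
        rw [G.dpair_nrm hAB (G.inv_all t _ _) (G.inv_all t _ _)]
    rw [key u v, key v u, Finset.sum_comm]
    congr 1
    · exact Finset.sum_congr rfl fun F _ => Finset.sum_congr rfl fun K _ => by ring
    · exact Finset.sum_congr rfl fun F _ => by ring
  · have : ∀ w F, G.dpair t w A F B = 0 := fun w F =>
      G.dpair_eq_zero t w (not_between hAB F)
    simp [hess, this]

lemma hess_self_right (u : P → R) (A B : P) :
    G.hess t u t A B = (G.deg A B - 1) • G.dvol t u A B := by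
  simp only [hess, dvol, dpair_self, mul_smul_comm, Finset.smul_sum]

end FlatSystem

/-- Simultaneous diagonalization of a symmetric form and a positive diagonal form. -/
lemma exists_generalized_eigenbasis {n : Type*} [Fintype n] (H : n → n → ℝ)
    (hsymm : ∀ F K, H F K = H K F) (p : n → ℝ) (hp : ∀ F, 0 < p F) :
    ∃ (g : n → n → ℝ) (l : n → ℝ), (∀ j F, ∑ K, H F K * g j K = l j * (p F * g j F)) ∧
      (∀ j, g j ≠ 0) ∧ ∀ (u : n → ℝ) F, u F = ∑ j, (∑ K, p K * g j K * u K) * g j F := by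
  classical
  set q : n → ℝ := fun F => Real.sqrt (p F) with hq
  have hq0 : ∀ F, 0 < q F := fun F => Real.sqrt_pos.2 (hp F)
  have hqq : ∀ F, q F * q F = p F := fun F => Real.mul_self_sqrt (hp F).le
  set B : Matrix n n ℝ := Matrix.of fun F K => H F K / (q F * q K) with hB
  have hBH : B.IsHermitian := by
    ext F K
    simp [hB, hsymm F K, mul_comm]
  set b := hBH.eigenvectorBasis with hb
  refine ⟨fun j F => b j F / q F, hBH.eigenvalues, fun j F => ?_, fun j h0 => ?_, fun u F => ?_⟩
  · have h1 := congrFun (hBH.mulVec_eigenvectorBasis j) F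
    simp only [Matrix.mulVec, dotProduct, hB, Matrix.of_apply, Pi.smul_apply, smul_eq_mul,
      ← hb] at h1
    calc ∑ K, H F K * (b j K / q K) = q F * ∑ K, H F K / (q F * q K) * b j K := by
          rw [Finset.mul_sum]
          refine Finset.sum_congr rfl fun K _ => ?_
          have := (hq0 F).ne'
          have := (hq0 K).ne'
          field_simp
      _ = _ := by
          rw [h1, ← hqq F]
          have := (hq0 F).ne'
          field_simp
  · apply b.orthonormal.ne_zero j
    ext F
    have := congrFun h0 F
    simpa [(hq0 F).ne'] using this
  · have h1 := b.sum_repr' (WithLp.toLp 2 fun K => q K * u K)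
    have h2 := congrArg (fun x : EuclideanSpace ℝ n => x F) h1
    simp only [WithLp.ofLp_sum, WithLp.ofLp_smul, Finset.sum_apply, Pi.smul_apply, smul_eq_mul,
      PiLp.inner_apply, RCLike.inner_apply, conj_trivial] at h2
    have h3 : u F = (q F * u F) / q F := by
      have := (hq0 F).ne'
      field_simp
    rw [h3, ← h2, Finset.sum_div]
    refine Finset.sum_congr rfl fun j _ => ?_
    rw [mul_div_assoc]
    congr 1
    refine Finset.sum_congr rfl fun K _ => ?_
    rw [← hqq K]
    have := (hq0 K).ne'
    field_simp

/-- A Perron–Frobenius criterion for a symmetric form with nonnegative off-diagonal entries to be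
nonpositive on the orthogonal complement of a positive vector. -/
lemma sum_mul_nonpos_of_irreducible {n : Type*} [Fintype n] (H : n → n → ℝ)
    (hsymm : ∀ F K, H F K = H K F) (hoff : ∀ F K, F ≠ K → 0 ≤ H F K)
    (hconn : ∀ S : n → Prop, (∃ F, S F) → (∀ F K, F ≠ K → S F → 0 < H F K → S K) → ∀ F, S F)
    (w : n → ℝ) (hw : ∀ F, 0 < w F) (hHw : ∀ F, 0 < ∑ K, H F K * w K)
    (hle : ∀ u : n → ℝ, ∑ F, u F * ∑ K, H F K * u K ≤
      ∑ F, w F * ((∑ K, H F K * u K) ^ 2 / ∑ K, H F K * w K))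
    (u : n → ℝ) (hu : ∑ F, u F * ∑ K, H F K * w K = 0) :
    ∑ F, u F * ∑ K, H F K * u K ≤ 0 := by
  classical
  set p : n → ℝ := fun F => (∑ K, H F K * w K) / w F with hpdef
  have hp : ∀ F, 0 < p F := fun F => div_pos (hHw F) (hw F)
  have hpw : ∀ F, ∑ K, H F K * w K = p F * w F := fun F => by
    simp only [hpdef]
    rw [div_mul_cancel₀ _ (hw F).ne']
  have key : ∀ (g : n → ℝ) (l : ℝ), (∀ F, ∑ K, H F K * g K = l * (p F * g F)) → 0 < l →
      (∃ F, 0 < g F) → ∃ c, ∀ F, g F = c * w F := by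
    intro g l hg hl ⟨F₁, hF₁⟩
    have hl1 : 1 ≤ l := by
      have h1 := hle g
      simp only [hg, hpw] at h1
      have h2 : ∑ F, g F * (l * (p F * g F)) = l * ∑ F, p F * g F ^ 2 := by
        rw [Finset.mul_sum]
        exact Finset.sum_congr rfl fun F _ => by ring
      have h3 : ∑ F, w F * ((l * (p F * g F)) ^ 2 / (p F * w F)) =
          l * (l * ∑ F, p F * g F ^ 2) := by
        rw [Finset.mul_sum, Finset.mul_sum]
        refine Finset.sum_congr rfl fun F _ => ?_
        have := (hp F).ne'
        have := (hw F).ne'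
        field_simp
      rw [h2, h3] at h1
      have h4 : 0 < ∑ F, p F * g F ^ 2 :=
        Finset.sum_pos' (fun F _ => mul_nonneg (hp F).le (sq_nonneg _))
          ⟨F₁, Finset.mem_univ _, mul_pos (hp F₁) (pow_pos hF₁ 2)⟩
      have h5 := le_of_mul_le_mul_left h1 hl
      nlinarith
    obtain ⟨F₀, -, hF₀⟩ := Finset.exists_max_image Finset.univ (fun F => g F / w F)
      ⟨F₁, Finset.mem_univ _⟩
    set c := g F₀ / w F₀ with hc
    have hc0 : 0 < c := (div_pos hF₁ (hw F₁)).trans_le (hF₀ F₁ (Finset.mem_univ _))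
    have hgc : ∀ F, g F ≤ c * w F := fun F => (div_le_iff₀ (hw F)).1 (hF₀ F (Finset.mem_univ _))
    refine ⟨c, hconn (fun F => g F = c * w F) ⟨F₀, ?_⟩ fun F K hFK hF hH => ?_⟩
    · rw [hc, div_mul_cancel₀ _ (hw F₀).ne']
    · have h1 : ∑ K, H F K * (c * w K - g K) = (1 - l) * (p F * (c * w F)) := by
        simp only [mul_sub, Finset.sum_sub_distrib, hg]
        have : ∑ K, H F K * (c * w K) = c * (p F * w F) := by
          rw [← hpw, Finset.mul_sum]
          exact Finset.sum_congr rfl fun K _ => by ring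
        rw [this, hF]
        ring
      have h2 : ∀ K ∈ Finset.univ, 0 ≤ H F K * (c * w K - g K) := fun K _ => by
        by_cases hK : F = K
        · subst hK
          rw [hF]
          simp
        · exact mul_nonneg (hoff F K hK) (sub_nonneg.2 (hgc K))
      have h3 : ∑ K, H F K * (c * w K - g K) ≤ 0 := by
        rw [h1]
        exact mul_nonpos_of_nonpos_of_nonneg (by linarith)
          (mul_pos (hp F) (mul_pos hc0 (hw F))).le
      have h4 := (Finset.sum_eq_zero_iff_of_nonneg h2).1 (h3.antisymm (Finset.sum_nonneg h2)) K
        (Finset.mem_univ _)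
      rcases mul_eq_zero.1 h4 with h | h
      · exact absurd h hH.ne'
      · linarith
  obtain ⟨g, l, hg, hg0, hexp⟩ := exists_generalized_eigenbasis H hsymm p hp
  have hQ : ∑ F, u F * ∑ K, H F K * u K = ∑ j, l j * (∑ K, p K * g j K * u K) ^ 2 := by
    have h1 : ∀ F, ∑ K, H F K * u K = ∑ j, (∑ K, p K * g j K * u K) * (l j * (p F * g j F)) := by
      intro F
      simp only [← hg, Finset.mul_sum]
      rw [Finset.sum_comm]
      refine Finset.sum_congr rfl fun K _ => ?_
      conv_lhs => rw [hexp u K, Finset.mul_sum]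
      exact Finset.sum_congr rfl fun j _ => by ring
    simp only [h1, Finset.mul_sum]
    rw [Finset.sum_comm]
    refine Finset.sum_congr rfl fun j _ => ?_
    rw [sq]
    set C := ∑ K, p K * g j K * u K with hC
    rw [hC, ← mul_assoc, Finset.mul_sum, ← hC]
    exact Finset.sum_congr rfl fun F _ => by ring
  rw [hQ]
  refine Finset.sum_nonpos fun j _ => ?_
  by_cases hl : l j ≤ 0
  · exact mul_nonpos_of_nonpos_of_nonneg hl (sq_nonneg _)
  · push Not at hl
    obtain ⟨c, hc⟩ : ∃ c, ∀ F, g j F = c * w F := by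
      obtain ⟨F, hF⟩ := Function.ne_iff.1 (hg0 j)
      rcases lt_or_gt_of_ne hF with h | h
      · obtain ⟨c, hc⟩ := key (fun F => - g j F) (l j)
          (fun F => by simp only [mul_neg, Finset.sum_neg_distrib, hg]) hl ⟨F, by simpa using h⟩
        exact ⟨-c, fun F => by have := hc F; linarith⟩
      · exact key (g j) (l j) (hg j) hl ⟨F, by simpa using h⟩
    have : ∑ K, p K * g j K * u K = 0 := by
      have h1 : ∑ K, p K * g j K * u K = c * ∑ F, u F * ∑ K, H F K * w K := by
        rw [Finset.mul_sum]
        exact Finset.sum_congr rfl fun K _ => by rw [hc, hpw]; ring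
      rw [h1, hu, mul_zero]
    rw [this]
    simp

namespace FlatSystem

open scoped Classical

variable {P E : Type*} [PartialOrder P] (G : FlatSystem P E) (w : P → ℝ)

open TrivSqZeroExt in
/-- The point `w` moved infinitesimally in direction `u`. -/
noncomputable def shift (w u : P → ℝ) (F : P) : DualNumber ℝ := inl (w F) + inr (u F)

lemma fst_chi (A B F : P) : (G.chi (DualNumber ℝ) A B F).fst = G.chi ℝ A B F := by
  unfold chi ind
  split_ifs <;> simp

lemma snd_chi (A B F : P) : (G.chi (DualNumber ℝ) A B F).snd = 0 := by
  unfold chi ind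
  split_ifs <;> simp

lemma fst_nrm (u : P → DualNumber ℝ) (A B F : P) :
    (G.nrm u A B F).fst = G.nrm (fun F => (u F).fst) A B F := by
  simp [nrm, fst_chi]

lemma snd_nrm (u : P → DualNumber ℝ) (A B F : P) :
    (G.nrm u A B F).snd = G.nrm (fun F => (u F).snd) A B F := by
  simp [nrm, fst_chi, snd_chi]

lemma exists_cover {A B : P} (h : A < B) : ∃ F, A < F ∧ F ≤ B ∧ G.rk F = G.rk A + 1 := by
  obtain ⟨i, hB, hA⟩ := G.exists_mem_notMem h
  obtain ⟨F, hF, -⟩ := G.existsUnique_cover h hB hA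
  exact ⟨F, hF.1, hF.2.1, hF.2.2.2⟩

variable [Fintype P]

theorem vol_shift (u : P → ℝ) (A B : P) :
    (G.vol (shift w u) A B).fst = G.vol w A B ∧
      (G.vol (shift w u) A B).snd = G.dvol w u A B := by
  induction hn : G.rk B - G.rk A using Nat.strong_induction_on generalizing A B with
  | _ n ih =>
  by_cases hAB : A < B
  swap
  · rw [vol_of_not_lt _ _ hAB, vol_of_not_lt _ _ hAB, dvol]
    simp [fun F => G.vol_mul_vol_eq_zero w (not_between hAB F)]
  by_cases hr : G.rk B = G.rk A + 1
  · rw [vol_of_cover _ _ hAB hr, vol_of_cover _ _ hAB hr, dvol_of_rk_le _ _ hr.le]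
    simp
  have hd : G.deg A B ≠ 0 := by
    intro h0
    apply hr
    have : (G.rk B : ℝ) = G.rk A + 1 := by
      simp only [deg] at h0
      linarith
    exact_mod_cast this
  have hlow : ∀ F, (G.vol (shift w u) A F * G.vol (shift w u) F B).fst =
      G.vol w A F * G.vol w F B ∧
      (G.vol (shift w u) A F * G.vol (shift w u) F B).snd = G.dpair w u A F B := by
    intro F
    by_cases hF : A < F ∧ F < B
    · have h1 := G.rk_lt hF.1
      have h2 := G.rk_lt hF.2
      obtain ⟨e1, e2⟩ := ih _ (by omega) A F rfl
      obtain ⟨e3, e4⟩ := ih _ (by omega) F B rfl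
      rw [TrivSqZeroExt.fst_mul, TrivSqZeroExt.snd_mul, e1, e2, e3, e4, dpair]
      refine ⟨rfl, ?_⟩
      simp only [smul_eq_mul, MulOpposite.smul_eq_mul_unop, MulOpposite.unop_op]
      ring
    · rw [vol_mul_vol_eq_zero _ _ hF, vol_mul_vol_eq_zero _ _ hF, dpair_eq_zero _ _ _ hF]
      simp
  have hs := G.deg_smul_vol (shift w u) A B
  have h1 := congrArg TrivSqZeroExt.fst hs
  have h2 := congrArg TrivSqZeroExt.snd hs
  simp only [dvol, TrivSqZeroExt.fst_smul, TrivSqZeroExt.snd_smul, TrivSqZeroExt.fst_sum,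
    TrivSqZeroExt.snd_sum] at h1 h2
  simp only [TrivSqZeroExt.fst_mul (G.nrm _ _ _ _), TrivSqZeroExt.snd_mul (G.nrm _ _ _ _), fst_nrm,
    snd_nrm, (hlow _).1, (hlow _).2, smul_eq_mul, MulOpposite.smul_eq_mul_unop,
    MulOpposite.unop_op] at h1 h2
  have e1 : (fun F => (shift w u F).fst) = w := by
    funext F; simp [shift]
  have e2 : (fun F => (shift w u F).snd) = u := by
    funext F; simp [shift]
  rw [e1] at h1 h2
  rw [e2, Finset.sum_add_distrib] at h2
  constructor
  · apply mul_left_cancel₀ hd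
    rw [h1]
    exact (G.deg_smul_vol w A B).symm
  · apply mul_left_cancel₀ hd
    rw [h2]
    have h3 : ∑ F, G.nrm w A B F * G.dpair w u A F B = (G.deg A B - 1) * G.dvol w u A B := by
      rw [← smul_eq_mul, ← hess_self_right, hess_comm, hess]
    have h4 : ∑ F, G.nrm u A B F * (G.vol w A F * G.vol w F B) = G.dvol w u A B := rfl
    rw [h3, h4]
    ring

lemma dvol_shift (u q : P → ℝ) (A B : P) :
    (G.dvol (shift w u) (fun F => TrivSqZeroExt.inl (q F)) A B).fst = G.dvol w q A B ∧
      (G.dvol (shift w u) (fun F => TrivSqZeroExt.inl (q F)) A B).snd = G.hess w q u A B := by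
  simp only [dvol, hess, TrivSqZeroExt.fst_sum, TrivSqZeroExt.snd_sum]
  constructor <;> refine Finset.sum_congr rfl fun F _ => ?_
  · simp [fst_nrm, (G.vol_shift w u _ _).1]
  · simp only [TrivSqZeroExt.fst_mul, TrivSqZeroExt.snd_mul, fst_nrm, snd_nrm,
      (G.vol_shift w u _ _).1, (G.vol_shift w u _ _).2, smul_eq_mul,
      MulOpposite.smul_eq_mul_unop, MulOpposite.unop_op, TrivSqZeroExt.fst_inl,
      TrivSqZeroExt.snd_inl, dpair]
    simp only [nrm]
    ring

/-- The Hessian of `vol w A F * vol w F B` in direction `u`. -/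
noncomputable def hpair (u : P → ℝ) (A F B : P) : ℝ :=
  G.hess w u u A F * G.vol w F B + 2 * (G.dvol w u A F * G.dvol w u F B)
    + G.vol w A F * G.hess w u u F B

theorem deg_sub_two_mul_hess (u : P → ℝ) (A B : P) :
    (G.deg A B - 2) * G.hess w u u A B = ∑ F, G.nrm w A B F * G.hpair w u A F B := by
  have h := congrArg TrivSqZeroExt.snd (G.hess_comm (shift w u)
    (fun F => TrivSqZeroExt.inl (w F)) (fun F => TrivSqZeroExt.inl (u F)) A B)
  simp only [hess, TrivSqZeroExt.snd_sum] at h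
  have hzero : G.nrm (fun _ => (0 : ℝ)) A B = fun _ => 0 := by
    funext F
    simp [nrm]
  simp only [TrivSqZeroExt.snd_mul, fst_nrm, snd_nrm, dpair, TrivSqZeroExt.snd_add,
    TrivSqZeroExt.fst_add, TrivSqZeroExt.fst_mul, (G.vol_shift w u _ _).1,
    (G.vol_shift w u _ _).2, (G.dvol_shift w u _ _ _).1, (G.dvol_shift w u _ _ _).2, smul_eq_mul,
    MulOpposite.smul_eq_mul_unop, MulOpposite.unop_op, TrivSqZeroExt.fst_inl,
    TrivSqZeroExt.snd_inl, hzero, zero_mul, add_zero] at h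
  refine Eq.symm ((Finset.sum_congr rfl fun F _ => ?_).trans (h.trans ?_))
  · simp only [hpair]
    ring
  rw [hess, Finset.mul_sum]
  refine Finset.sum_congr rfl fun F _ => ?_
  have h2 : ∀ X Y, G.hess w w u X Y = (G.deg X Y - 1) * G.dvol w u X Y := fun X Y => by
    rw [hess_comm, hess_self_right, smul_eq_mul]
  have h3 : ∀ X Y, G.dvol w w X Y = G.deg X Y * G.vol w X Y := fun X Y => by
    rw [← deg_smul_vol, smul_eq_mul]
  rw [h2, h2, h3, h3, dpair]
  have h4 : G.deg A B - 2 = G.deg A F + G.deg F B - 1 := by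
    rw [deg_add_deg]
    ring
  rw [h4]
  ring

variable {w} in
lemma vol_modular {v : P → ℝ} (c : ℝ) (m : E → ℝ)
    (hv : ∀ F, v F = w F + c + ∑ e ∈ G.pts F, m e) : G.vol v = G.vol w := by
  funext A B
  induction hn : G.rk B - G.rk A using Nat.strong_induction_on generalizing A B with
  | _ n ih =>
  by_cases hAB : A < B
  swap
  · rw [vol_of_not_lt _ _ hAB, vol_of_not_lt _ _ hAB]
  by_cases hr : G.rk B = G.rk A + 1
  · rw [vol_of_cover _ _ hAB hr, vol_of_cover _ _ hAB hr]
  have hd : G.deg A B ≠ 0 := by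
    intro h0
    apply hr
    have : (G.rk B : ℝ) = G.rk A + 1 := by
      simp only [deg] at h0
      linarith
    exact_mod_cast this
  apply mul_left_cancel₀ hd
  rw [← smul_eq_mul, ← smul_eq_mul, deg_smul_vol, deg_smul_vol,
    ← G.dvol_modular (G.inv_all w A B) c m hv]
  refine Finset.sum_congr rfl fun F _ => ?_
  congr 1
  by_cases hF : A < F ∧ F < B
  · have h1 := G.rk_lt hF.1
    have h2 := G.rk_lt hF.2
    rw [ih _ (by omega) A F rfl, ih _ (by omega) F B rfl]
  · rw [vol_mul_vol_eq_zero _ _ hF, vol_mul_vol_eq_zero _ _ hF]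

/-- On every interval, `w` differs by a modular function from a function that vanishes at the
ends and is positive in between. -/
def Ample : Prop :=
  ∀ A B : P, A < B → ∃ (v : P → ℝ) (c : ℝ) (m : E → ℝ),
    (∀ F, v F = w F + c + ∑ e ∈ G.pts F, m e) ∧ v A = 0 ∧ v B = 0 ∧
      ∀ F, A < F → F < B → 0 < v F

variable {w}

theorem vol_pos (hw : G.Ample w) {A B : P} (hAB : A < B) : 0 < G.vol w A B := by
  induction hn : G.rk B - G.rk A using Nat.strong_induction_on generalizing A B with
  | _ n ih =>
  by_cases hr : G.rk B = G.rk A + 1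
  · rw [vol_of_cover _ _ hAB hr]
    exact one_pos
  have h1 := G.rk_lt hAB
  have hd : 0 < G.deg A B := by
    have : (G.rk A : ℝ) + 2 ≤ G.rk B := by exact_mod_cast (by omega : G.rk A + 2 ≤ G.rk B)
    simp only [deg]
    linarith
  obtain ⟨v, c, m, hv, hA, hB, hpos⟩ := hw A B hAB
  have h2 : 0 < G.deg A B * G.vol w A B := by
    rw [← smul_eq_mul, deg_smul_vol, ← G.dvol_modular (G.inv_all w A B) c m hv, dvol,
      G.nrm_eq_self hA hB]
    obtain ⟨K, hK1, hK2, hK3⟩ := G.exists_cover hAB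
    have hK : K < B := lt_of_le_of_ne hK2 fun h => by rw [h] at hK3; omega
    have hp : ∀ F, A < F → F < B → 0 < v F * (G.vol w A F * G.vol w F B) := fun F h3 h4 => by
      have h5 := G.rk_lt h3
      have h6 := G.rk_lt h4
      exact mul_pos (hpos F h3 h4) (mul_pos (ih _ (by omega) h3 rfl) (ih _ (by omega) h4 rfl))
    refine Finset.sum_pos' (fun F _ => ?_) ⟨K, Finset.mem_univ _, hp K hK1 hK⟩
    by_cases hF : A < F ∧ F < B
    · exact (hp F hF.1 hF.2).le
    · rw [vol_mul_vol_eq_zero _ _ hF, mul_zero]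
  exact pos_of_mul_pos_right h2 hd.le

end FlatSystem

namespace FlatSystem

open scoped Classical

variable {P E : Type*} [PartialOrder P] [Fintype P] (G : FlatSystem P E) (w : P → ℝ)

lemma hess_add_mul_left (u v q : P → ℝ) (c : ℝ) (A B : P) :
    G.hess w (fun F => u F + c * v F) q A B = G.hess w u q A B + c * G.hess w v q A B := by
  simp only [hess, Finset.mul_sum, ← Finset.sum_add_distrib]
  exact Finset.sum_congr rfl fun F _ => by simp only [nrm]; ring

lemma hess_add_mul_self (u v : P → ℝ) (c : ℝ) (A B : P) :
    G.hess w (fun F => u F + c * v F) (fun F => u F + c * v F) A B =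
      G.hess w u u A B + 2 * c * G.hess w u v A B + c ^ 2 * G.hess w v v A B := by
  rw [hess_add_mul_left, G.hess_comm w u, G.hess_comm w v, hess_add_mul_left, hess_add_mul_left,
    G.hess_comm w v u]
  ring

lemma hess_nrm_self {A B : P} (h : A < B) (u : P → ℝ) :
    G.hess w (G.nrm u A B) (G.nrm u A B) A B = G.hess w u u A B := by
  rw [hess, G.nrm_eq_self (G.nrm_left h u) (G.nrm_right h u), hess]
  exact Finset.sum_congr rfl fun F _ => by
    rw [G.dpair_nrm h (G.inv_all w _ _) (G.inv_all w _ _)]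

lemma hess_of_rk_le_two {A B : P} (h : G.rk B ≤ G.rk A + 2) (u v : P → ℝ) :
    G.hess w u v A B = 0 := by
  refine Finset.sum_eq_zero fun F _ => ?_
  by_cases hF : A < F ∧ F < B
  · have h1 := G.rk_lt hF.1
    have h2 := G.rk_lt hF.2
    rw [dpair, G.dvol_of_rk_le w (by omega), G.dvol_of_rk_le w (by omega)]
    ring
  · rw [G.dpair_eq_zero _ _ hF, mul_zero]

/-- A multiple of `w` that makes `u` lie in the negative cone yields the reverse
Cauchy–Schwarz inequality. -/
lemma deg_mul_vol_mul_hess_le_of_exists {u : P → ℝ} {A B : P} (hd : 1 < G.deg A B)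
    (hv : 0 < G.vol w A B)
    (h : ∃ c, G.hess w (fun F => u F + c * w F) (fun F => u F + c * w F) A B ≤ 0) :
    G.deg A B * G.vol w A B * G.hess w u u A B ≤ (G.deg A B - 1) * G.dvol w u A B ^ 2 := by
  obtain ⟨c, h⟩ := h
  rw [hess_add_mul_self, hess_self_right, hess_self_right, ← deg_smul_vol] at h
  simp only [smul_eq_mul] at h
  have h1 : 0 < G.deg A B * G.vol w A B := mul_pos (by linarith) hv
  have h2 := mul_le_mul_of_nonneg_left h h1.le
  have h3 := mul_nonneg (sub_nonneg.2 hd.le)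
    (sq_nonneg (G.dvol w u A B + c * (G.deg A B * G.vol w A B)))
  nlinarith

/-- The Hessian on an interval of rank three. -/
lemma hess_of_rk_three {u : P → ℝ} {A B : P} (hAB : A < B) (hr : G.rk B = G.rk A + 3)
    (hA : u A = 0) (hB : u B = 0) :
    G.hess w u u A B = (∑ p with A < p ∧ p < B ∧ G.rk p = G.rk A + 1, u p) ^ 2
      - ∑ l with A < l ∧ l < B ∧ G.rk l = G.rk A + 2, G.dvol w u A l ^ 2 := by
  set PT : Finset P := {p | A < p ∧ p < B ∧ G.rk p = G.rk A + 1} with hPT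
  set LN : Finset P := {l | A < l ∧ l < B ∧ G.rk l = G.rk A + 2} with hLN
  have mPT : ∀ p, p ∈ PT ↔ A < p ∧ p < B ∧ G.rk p = G.rk A + 1 := by simp [hPT]
  have mLN : ∀ p, p ∈ LN ↔ A < p ∧ p < B ∧ G.rk p = G.rk A + 2 := by simp [hLN]
  have hdisj : Disjoint PT LN := Finset.disjoint_left.2 fun F h1 h2 => by
    have := ((mPT F).1 h1).2.2
    have := ((mLN F).1 h2).2.2
    omega
  have hvA : ∀ p ∈ PT, G.vol w A p = 1 := fun p hp =>
    G.vol_of_cover w ((mPT p).1 hp).1 ((mPT p).1 hp).2.2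
  have hvB : ∀ l ∈ LN, G.vol w l B = 1 := fun l hl =>
    G.vol_of_cover w ((mLN l).1 hl).2.1 (by rw [((mLN l).1 hl).2.2, hr])
  have hpl : ∀ p ∈ PT, ∀ l ∈ LN, p < l → G.vol w p l = 1 := fun p hp l hl h =>
    G.vol_of_cover w h (by rw [((mPT p).1 hp).2.2, ((mLN l).1 hl).2.2])
  have hQ : G.hess w u u A B =
      ∑ p ∈ PT, u p * G.dvol w u p B + ∑ l ∈ LN, u l * G.dvol w u A l := by
    rw [hess, G.nrm_eq_self hA hB, ← Finset.sum_subset (Finset.subset_univ (PT ∪ LN)),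
      Finset.sum_union hdisj]
    · congr 1 <;> refine Finset.sum_congr rfl fun F hF => ?_
      · rw [dpair, hvA F hF, G.dvol_of_rk_le w (((mPT F).1 hF).2.2).le]
        ring
      · rw [dpair, hvB F hF, G.dvol_of_rk_le w (A := F) (B := B)
          (by rw [hr, ((mLN F).1 hF).2.2])]
        ring
    · intro F _ hF
      rw [G.dpair_eq_zero w, mul_zero]
      rintro ⟨h1, h2⟩
      have h3 := G.rk_lt h1
      have h4 := G.rk_lt h2
      rw [Finset.mem_union, mPT, mLN] at hF
      apply hF
      rcases (by omega : G.rk F = G.rk A + 1 ∨ G.rk F = G.rk A + 2) with h5 | h5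
      · exact Or.inl ⟨h1, h2, h5⟩
      · exact Or.inr ⟨h1, h2, h5⟩
  have hdp : ∀ (f : P → ℝ), ∀ p ∈ PT,
      ∑ F, f F * (G.vol w p F * G.vol w F B) = ∑ l ∈ LN, G.vol w p l * f l := fun f p hp => by
    rw [← Finset.sum_subset (Finset.subset_univ LN)]
    · refine Finset.sum_congr rfl fun l hl => ?_
      rw [hvB l hl]
      ring
    · intro F _ hF
      rw [vol_mul_vol_eq_zero, mul_zero]
      rintro ⟨h1, h2⟩
      have h3 := G.rk_lt h1
      have h4 := G.rk_lt h2
      have h5 := (mPT p).1 hp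
      exact hF ((mLN F).2 ⟨h5.1.trans h1, h2, by omega⟩)
  have hdl : ∀ l ∈ LN, G.dvol w u A l = ∑ p ∈ PT, G.vol w p l * u p - u l := fun l hl => by
    have h5 := (mLN l).1 hl
    rw [dvol_eq, G.svol_of_rk_two w h5.1 h5.2.2, hA, zero_mul, sub_zero, mul_one,
      ← Finset.sum_subset (Finset.subset_univ PT)]
    · congr 1
      refine Finset.sum_congr rfl fun p hp => ?_
      rw [hvA p hp]
      ring
    · intro F _ hF
      rw [vol_mul_vol_eq_zero, mul_zero]
      rintro ⟨h1, h2⟩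
      have h3 := G.rk_lt h1
      have h4 := G.rk_lt h2
      exact hF ((mPT F).2 ⟨h1, h2.trans h5.2.1, by omega⟩)
  have hpq : ∀ p ∈ PT, ∀ q ∈ PT, ∑ l ∈ LN, G.vol w p l * G.vol w q l =
      1 + if p = q then G.pvol w p B else 0 := fun p hp q hq => by
    have h5 := (mPT p).1 hp
    have h6 := (mPT q).1 hq
    have hr2 : G.rk B = G.rk p + 2 := by omega
    split_ifs with h
    · rw [← h, ← G.svol_of_rk_two w h5.2.1 hr2, add_comm, pvol_add_svol]
      have := hdp (fun _ => 1) p hp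
      simp only [one_mul, mul_one] at this
      rw [this]
      refine Finset.sum_congr rfl fun l hl => ?_
      by_cases hl' : p < l
      · rw [hpl p hp l hl hl', mul_one]
      · rw [G.vol_of_not_lt w hl', mul_zero]
    · obtain ⟨i, hiq, hip⟩ : ∃ i ∈ G.pts q, i ∉ G.pts p := by
        by_contra! hc
        rcases (G.le_iff.2 hc).lt_or_eq with h7 | h7
        · have := G.rk_lt h7
          omega
        · exact h h7.symm
      rw [add_zero, ← G.sum_ind_mul_of_rk_two (R := ℝ) w h5.2.1 hr2
        (G.mem_of_le h6.2.1.le hiq) hip, hdp _ p hp]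
      refine Finset.sum_congr rfl fun l hl => ?_
      by_cases hl' : p < l
      · congr 1
        have h8 := (mLN l).1 hl
        by_cases hil : i ∈ G.pts l
        · rw [G.ind_of_mem hil]
          apply hpl q hq l hl
          obtain ⟨F, hF, -⟩ := G.existsUnique_cover h8.1 hil
            (fun h => hip (G.mem_of_le h5.1.le h))
          obtain ⟨F', -, hF'⟩ := G.existsUnique_cover h6.1 hiq
            (fun h => hip (G.mem_of_le h5.1.le h))
          obtain ⟨K, -, hK⟩ := G.existsUnique_cover hAB (G.mem_of_le h8.2.1.le hil)
            (fun h => hip (G.mem_of_le h5.1.le h))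
          have e : q = F := (hK q ⟨h6.1, h6.2.1.le, hiq, h6.2.2⟩).trans
            (hK F ⟨hF.1, hF.2.1.trans h8.2.1.le, hF.2.2⟩).symm
          refine lt_of_le_of_ne (e ▸ hF.2.1) fun h9 => ?_
          have := congrArg G.rk h9
          omega
        · rw [G.ind_of_notMem hil, G.vol_of_not_lt w fun h9 => hil (G.mem_of_le h9.le hiq)]
      · rw [G.vol_of_not_lt w hl', zero_mul, zero_mul]
  have hS : ∑ l ∈ LN, (∑ p ∈ PT, G.vol w p l * u p) ^ 2 =
      (∑ p ∈ PT, u p) ^ 2 + ∑ p ∈ PT, u p ^ 2 * G.pvol w p B := by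
    have e1 : ∑ l ∈ LN, (∑ p ∈ PT, G.vol w p l * u p) ^ 2 =
        ∑ p ∈ PT, ∑ q ∈ PT, u p * u q * ∑ l ∈ LN, G.vol w p l * G.vol w q l := by
      simp only [sq, Finset.sum_mul_sum]
      rw [Finset.sum_comm]
      refine Finset.sum_congr rfl fun p _ => ?_
      rw [Finset.sum_comm]
      simp only [Finset.mul_sum]
      exact Finset.sum_congr rfl fun q _ => Finset.sum_congr rfl fun l _ => by ring
    rw [e1, sq, Finset.sum_mul_sum, ← Finset.sum_add_distrib]
    refine Finset.sum_congr rfl fun p hp => ?_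
    rw [Finset.sum_congr rfl fun q hq => by rw [hpq p hp q hq]]
    simp only [mul_add, mul_one, Finset.sum_add_distrib, mul_ite, mul_zero, Finset.sum_ite_eq,
      if_pos hp, sq]
  have h1 : ∑ p ∈ PT, u p * G.dvol w u p B =
      ∑ l ∈ LN, u l * (∑ p ∈ PT, G.vol w p l * u p) - ∑ p ∈ PT, u p ^ 2 * G.pvol w p B := by
    have e1 : ∑ l ∈ LN, u l * (∑ p ∈ PT, G.vol w p l * u p) =
        ∑ p ∈ PT, u p * ∑ l ∈ LN, G.vol w p l * u l := by
      simp only [Finset.mul_sum]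
      rw [Finset.sum_comm]
      exact Finset.sum_congr rfl fun q _ => Finset.sum_congr rfl fun l _ => by ring
    rw [e1, ← Finset.sum_sub_distrib]
    refine Finset.sum_congr rfl fun p hp => ?_
    rw [dvol_eq, hB, hdp _ p hp]
    ring
  rw [hQ, h1, eq_sub_iff_add_eq, ← add_left_inj (∑ p ∈ PT, u p ^ 2 * G.pvol w p B), ← hS]
  have e : ∑ l ∈ LN, (∑ p ∈ PT, G.vol w p l * u p) ^ 2 =
      ∑ l ∈ LN, u l * (∑ p ∈ PT, G.vol w p l * u p) + ∑ l ∈ LN, u l * G.dvol w u A l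
        + ∑ l ∈ LN, G.dvol w u A l ^ 2 := by
    rw [← Finset.sum_add_distrib, ← Finset.sum_add_distrib]
    refine Finset.sum_congr rfl fun l hl => ?_
    rw [hdl l hl]
    ring
  rw [e]
  ring

lemma exists_hess_nonpos_of_rk_three {u : P → ℝ} {A B : P} (hAB : A < B)
    (hr : G.rk B = G.rk A + 3) (hA : w A = 0) (hB : w B = 0) (hpos : ∀ F, A < F → F < B → 0 < w F)
    (huA : u A = 0) (huB : u B = 0) :
    ∃ c, G.hess w (fun F => u F + c * w F) (fun F => u F + c * w F) A B ≤ 0 := by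
  set PT : Finset P := {p | A < p ∧ p < B ∧ G.rk p = G.rk A + 1} with hPT
  have hw : 0 < ∑ p ∈ PT, w p := by
    obtain ⟨K, hK1, hK2, hK3⟩ := G.exists_cover hAB
    have hK : K < B := lt_of_le_of_ne hK2 fun h => by rw [h] at hK3; omega
    refine Finset.sum_pos (fun F hF => ?_) ⟨K, ?_⟩
    · simp only [hPT, Finset.mem_filter] at hF
      exact hpos F hF.2.1 hF.2.2.1
    · simp [hPT, hK1, hK, hK3]
  refine ⟨-(∑ p ∈ PT, u p) / ∑ p ∈ PT, w p, ?_⟩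
  rw [G.hess_of_rk_three w hAB hr (by simp [hA, huA]) (by simp [hB, huB])]
  rw [Finset.sum_add_distrib, ← Finset.mul_sum, ← hPT, div_mul_cancel₀ _ hw.ne', add_neg_cancel]
  have : 0 ≤ ∑ l with A < l ∧ l < B ∧ G.rk l = G.rk A + 2, G.dvol w (fun F => u F +
      -(∑ p ∈ PT, u p) / (∑ p ∈ PT, w p) * w F) A l ^ 2 :=
    Finset.sum_nonneg fun _ _ => sq_nonneg _
  linarith

end FlatSystem

lemma mul_mul_hessian_le {f g a b fu gu fuu guu : ℝ} (ha : 0 ≤ a) (hb : 0 ≤ b)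
    (hfu : a * f * fuu ≤ (a - 1) * fu ^ 2) (hgu : b * g * guu ≤ (b - 1) * gu ^ 2)
    (ha0 : a = 0 → fu = 0 ∧ fuu = 0) (hb0 : b = 0 → gu = 0 ∧ guu = 0) :
    (a + b) * (f * g) * (fuu * g + 2 * (fu * gu) + f * guu) ≤
      (a + b - 1) * (fu * g + f * gu) ^ 2 := by
  rcases ha.eq_or_lt with h | h
  · obtain ⟨rfl, rfl⟩ := ha0 h.symm
    rw [← h]
    have := mul_le_mul_of_nonneg_left hgu (sq_nonneg f)
    nlinarith
  rcases hb.eq_or_lt with h' | h'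
  · obtain ⟨rfl, rfl⟩ := hb0 h'.symm
    rw [← h']
    have := mul_le_mul_of_nonneg_left hfu (sq_nonneg g)
    nlinarith
  have h1 := mul_le_mul_of_nonneg_left hfu (mul_nonneg (sq_nonneg g) hb)
  have h2 := mul_le_mul_of_nonneg_left hgu (mul_nonneg (sq_nonneg f) ha)
  have h3 := mul_le_mul_of_nonneg_left (add_le_add h1 h2) (add_nonneg ha hb)
  have h4 := sq_nonneg (b * (fu * g) - a * (f * gu))
  refine le_of_mul_le_mul_left ?_ (mul_pos h h')
  nlinarith

namespace FlatSystem

open scoped Classical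

variable {P E : Type*} [PartialOrder P] (G : FlatSystem P E)

/-- The proper part of an interval of rank at least three is connected. -/
lemma between_connected {A B : P} (hr : G.rk A + 3 ≤ G.rk B) {S : P → Prop}
    (hS : ∀ F K, A < F → F < B → A < K → K < B → (F < K ∨ K < F) → S F → S K)
    {F K : P} (hF1 : A < F) (hF2 : F < B) (hK1 : A < K) (hK2 : K < B) (hF : S F) : S K := by
  obtain ⟨p, hp1, hp2, hp3⟩ := G.exists_cover hF1
  obtain ⟨q, hq1, hq2, hq3⟩ := G.exists_cover hK1
  have hpB := hp2.trans_lt hF2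
  have hqB := hq2.trans_lt hK2
  have hAB := hF1.trans hF2
  have hp : S p := by
    rcases hp2.lt_or_eq with h | h
    · exact hS F p hF1 hF2 hp1 hpB (Or.inr h) hF
    · exact h ▸ hF
  suffices hq : S q by
    rcases hq2.lt_or_eq with h | h
    · exact hS q K hq1 hqB hK1 hK2 (Or.inl h) hq
    · exact h ▸ hq
  by_cases hpq : p = q
  · exact hpq ▸ hp
  obtain ⟨i, hiq, hip⟩ : ∃ i ∈ G.pts q, i ∉ G.pts p := by
    by_contra! hc
    rcases (G.le_iff.2 hc).lt_or_eq with h7 | h7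
    · have := G.rk_lt h7
      omega
    · exact hpq h7.symm
  have hiA : i ∉ G.pts A := fun h => hip (G.mem_of_le hp1.le h)
  have hiB := G.mem_of_le hqB.le hiq
  obtain ⟨L, ⟨hL1, hL2, hL3, hL4⟩, -⟩ := G.existsUnique_cover hpB hiB hip
  have hLB : L < B := lt_of_le_of_ne hL2 fun h => by rw [h] at hL4; omega
  have hAL := hp1.trans hL1
  obtain ⟨q', hq', -⟩ := G.existsUnique_cover hAL hL3 hiA
  obtain ⟨K', -, hK'⟩ := G.existsUnique_cover hAB hiB hiA
  have e : q = q' := (hK' q ⟨hq1, hqB.le, hiq, hq3⟩).trans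
    (hK' q' ⟨hq'.1, hq'.2.1.trans hL2, hq'.2.2⟩).symm
  have hqL : q < L := lt_of_le_of_ne (e ▸ hq'.2.1) fun h => by
    have := congrArg G.rk h
    omega
  exact hS L q hAL hLB hq1 hqB (Or.inr hqL) (hS p L hp1 hpB hAL hLB (Or.inl hL1) hp)

variable [Fintype P] (w : P → ℝ)

/-- The coefficients of the Hessian form of `[A, B]`. -/
noncomputable def hcoef (A B F K : P) : ℝ :=
  (G.vol w A K * G.vol w K F * G.vol w F B + G.vol w A F * G.vol w F K * G.vol w K B)
    - if F = K then G.svol w A F * G.vol w F B + G.vol w A F * G.pvol w F B else 0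

lemma hcoef_symm (A B F K : P) : G.hcoef w A B F K = G.hcoef w A B K F := by
  by_cases h : F = K
  · rw [h]
  · rw [hcoef, hcoef, if_neg h, if_neg (Ne.symm h)]
    ring

lemma sum_subtype_between {A B : P} (f : P → ℝ) (hf : ∀ F, ¬ (A < F ∧ F < B) → f F = 0) :
    ∑ F, f F = ∑ F : {F // A < F ∧ F < B}, f F := by
  rw [← Finset.sum_subset (Finset.subset_univ ({F | A < F ∧ F < B} : Finset P))]
  · exact Finset.sum_subtype _ (by simp) f
  · intro F _ hF
    exact hf F (by simpa using hF)

lemma dpair_eq_sum_hcoef {u : P → ℝ} {A B F : P} (hA : u A = 0) (hB : u B = 0) :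
    G.dpair w u A F B = ∑ K : {K // A < K ∧ K < B}, G.hcoef w A B F K * u K := by
  rw [← sum_subtype_between fun K => G.hcoef w A B F K * u K]
  · have h := G.sum_dpair w hA hB (fun K => if F = K then 1 else 0)
    simp only [ite_mul, one_mul, zero_mul, Finset.sum_ite_eq, Finset.mem_univ, if_true] at h
    simp only [hcoef, sub_mul, Finset.sum_sub_distrib, ite_mul, zero_mul, Finset.sum_ite_eq,
      Finset.mem_univ, if_true]
    rw [h]
    rw [Finset.sum_comm]
    simp only [Finset.sum_ite_eq, Finset.mem_univ, if_true]
    congr 1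
    · exact Finset.sum_congr rfl fun K _ => by ring
    · ring
  · intro K hK
    have h1 : G.vol w A K * G.vol w K F * G.vol w F B = 0 := by
      by_cases h : A < K
      · by_cases h' : K < F
        · rw [G.vol_of_not_lt w (A := F) fun h'' => hK ⟨h, h'.trans h''⟩, mul_zero]
        · rw [G.vol_of_not_lt w h', mul_zero, zero_mul]
      · rw [G.vol_of_not_lt w h, zero_mul, zero_mul]
    have h2 : G.vol w A F * G.vol w F K * G.vol w K B = 0 := by
      by_cases h : K < B
      · by_cases h' : F < K
        · rw [G.vol_of_not_lt w (A := A) fun h'' => hK ⟨h''.trans h', h⟩, zero_mul, zero_mul]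
        · rw [G.vol_of_not_lt w h', mul_zero, zero_mul]
      · rw [G.vol_of_not_lt w h, mul_zero]
    rw [hcoef, h1, h2]
    split_ifs with h
    · subst h
      have hz : ∀ X Y, ¬ X < Y → G.svol w X Y = 0 ∧ G.pvol w X Y = 0 := fun X Y hXY => by
        simp [svol, pvol, fun F => G.vol_mul_vol_eq_zero w (not_between hXY F)]
      rw [not_and_or] at hK
      rcases hK with hK | hK
      · rw [(hz _ _ hK).1, G.vol_of_not_lt w hK]
        ring
      · rw [(hz _ _ hK).2, G.vol_of_not_lt w hK]
        ring
    · ring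

lemma exists_hess_nonpos_of_four_le {u : P → ℝ} {A B : P} (hr : G.rk A + 4 ≤ G.rk B)
    (hA : w A = 0) (hB : w B = 0) (hpos : ∀ F, A < F → F < B → 0 < w F)
    (huA : u A = 0) (huB : u B = 0) (hv : ∀ {X Y}, X < Y → 0 < G.vol w X Y)
    (ih : ∀ (u : P → ℝ) (X Y : P), X < Y → G.rk Y - G.rk X < G.rk B - G.rk A →
      G.deg X Y * G.vol w X Y * G.hess w u u X Y ≤ (G.deg X Y - 1) * G.dvol w u X Y ^ 2) :
    ∃ c, G.hess w (fun F => u F + c * w F) (fun F => u F + c * w F) A B ≤ 0 := by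
  have hd : 3 ≤ G.deg A B := by
    have : (G.rk A : ℝ) + 4 ≤ G.rk B := by exact_mod_cast hr
    simp only [deg]
    linarith
  have hvn : ∀ X Y, 0 ≤ G.vol w X Y := fun X Y => by
    by_cases h : X < Y
    · exact (hv h).le
    · rw [vol_of_not_lt _ _ h]
  by_cases hAB : A < B
  swap
  · exact ⟨0, le_of_eq (Finset.sum_eq_zero fun F _ => by
      rw [G.dpair_eq_zero _ _ (not_between hAB F), mul_zero])⟩
  have hhess : ∀ u v : P → ℝ, u A = 0 → u B = 0 → v A = 0 → v B = 0 → G.hess w u v A B =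
      ∑ F : {F // A < F ∧ F < B}, u F * ∑ K : {K // A < K ∧ K < B},
        G.hcoef w A B F K * v K := fun u v h1 h2 h3 h4 => by
    rw [hess, G.nrm_eq_self h1 h2, sum_subtype_between (A := A) (B := B)]
    · simp only [G.dpair_eq_sum_hcoef w h3 h4]
    · intro F hF
      rw [G.dpair_eq_zero _ _ hF, mul_zero]
  have hdw : ∀ F : {F // A < F ∧ F < B}, ∑ K : {K // A < K ∧ K < B}, G.hcoef w A B F K * w K =
      (G.deg A B - 1) * (G.vol w A F * G.vol w F B) := fun F => by
    rw [← G.dpair_eq_sum_hcoef w hA hB, dpair_self, smul_eq_mul]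
  have hww : 0 < G.hess w w w A B := by
    rw [hess_self_right, ← deg_smul_vol, smul_eq_mul, smul_eq_mul]
    exact mul_pos (by linarith) (mul_pos (by linarith) (hv hAB))
  set c : ℝ := - G.hess w u w A B / G.hess w w w A B with hc
  refine ⟨c, ?_⟩
  set q : P → ℝ := fun F => u F + c * w F with hq
  have hqA : q A = 0 := by simp [hq, hA, huA]
  have hqB : q B = 0 := by simp [hq, hB, huB]
  have hqw : G.hess w q w A B = 0 := by
    rw [hq, hess_add_mul_left, hc, div_mul_cancel₀ _ hww.ne', add_neg_cancel]
  rw [hhess q q hqA hqB hqA hqB]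
  refine sum_mul_nonpos_of_irreducible (fun F K : {F // A < F ∧ F < B} => G.hcoef w A B F K)
    (fun F K => G.hcoef_symm w A B F K) ?_ ?_ (fun F => w F) (fun F => hpos F F.2.1 F.2.2) ?_ ?_
    (fun F => q F) ?_
  · intro F K hFK
    simp only [hcoef, if_neg (fun h => hFK (Subtype.ext h)), sub_zero]
    exact add_nonneg (mul_nonneg (mul_nonneg (hvn _ _) (hvn _ _)) (hvn _ _))
      (mul_nonneg (mul_nonneg (hvn _ _) (hvn _ _)) (hvn _ _))
  · rintro S ⟨F, hF⟩ hS K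
    have := G.between_connected (S := fun F => ∀ h : A < F ∧ F < B, S ⟨F, h⟩)
      (by omega) ?_ F.2.1 F.2.2 K.2.1 K.2.2 (fun _ => hF)
    · exact this K.2
    · intro X Y hX1 hX2 hY1 hY2 hXY hX hY
      have hne : X ≠ Y := fun h => by
        rcases hXY with h' | h'
        · exact h'.ne h
        · exact h'.ne h.symm
      refine hS ⟨X, hX1, hX2⟩ ⟨Y, hY⟩ (fun h => hne (congrArg Subtype.val h)) (hX ⟨hX1, hX2⟩) ?_
      simp only [hcoef, if_neg hne, sub_zero]
      rcases hXY with h' | h'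
      · exact add_pos_of_nonneg_of_pos (mul_nonneg (mul_nonneg (hvn _ _) (hvn _ _)) (hvn _ _))
          (mul_pos (mul_pos (hv hX1) (hv h')) (hv hY2))
      · exact add_pos_of_pos_of_nonneg (mul_pos (mul_pos (hv hY1) (hv h')) (hv hX2))
          (mul_nonneg (mul_nonneg (hvn _ _) (hvn _ _)) (hvn _ _))
  · intro F
    simp only [hdw]
    exact mul_pos (by linarith) (mul_pos (hv F.2.1) (hv F.2.2))
  · intro z
    set y : P → ℝ := fun F => if h : A < F ∧ F < B then z ⟨F, h⟩ else 0 with hy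
    have hyz : ∀ F : {F // A < F ∧ F < B}, z F = y F := fun F => by
      simp only [hy, dif_pos F.2]
    have hyA : y A = 0 := dif_neg fun h => h.1.ne rfl
    have hyB : y B = 0 := dif_neg fun h => h.2.ne rfl
    simp only [hyz]
    simp only [hdw, ← G.dpair_eq_sum_hcoef w hyA hyB]
    have h1 := G.deg_sub_two_mul_hess w y A B
    rw [G.nrm_eq_self hA hB, sum_subtype_between (A := A) (B := B)] at h1
    swap
    · intro F hF
      have hz : ∀ X Y, ¬ X < Y → G.vol w X Y = 0 ∧ G.dvol w y X Y = 0 ∧ G.hess w y y X Y = 0 :=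
        fun X Y hXY => ⟨G.vol_of_not_lt w hXY, by
          simp [dvol, fun F => G.vol_mul_vol_eq_zero w (not_between hXY F)], by
          simp [hess, fun F => G.dpair_eq_zero w y (not_between hXY F)]⟩
      rw [not_and_or] at hF
      rcases hF with hF | hF <;> obtain ⟨e1, e2, e3⟩ := hz _ _ hF <;> rw [hpair, e1, e2, e3] <;>
        ring
    rw [hess, G.nrm_eq_self hyA hyB, sum_subtype_between (A := A) (B := B)] at h1
    swap
    · intro F hF
      rw [G.dpair_eq_zero _ _ hF, mul_zero]
    refine le_of_mul_le_mul_left ?_ (by linarith : 0 < G.deg A B - 2)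
    rw [h1, Finset.mul_sum]
    refine Finset.sum_le_sum fun F _ => ?_
    have hF1 := F.2.1
    have hF2 := F.2.2
    have r1 := G.rk_lt hF1
    have r2 := G.rk_lt hF2
    have hdeg : ∀ {X Y}, X < Y → 0 ≤ G.deg X Y := fun {X Y} h => by
      have : (G.rk X : ℝ) + 1 ≤ G.rk Y := by exact_mod_cast G.rk_lt h
      simp only [deg]
      linarith
    have hdeg0 : ∀ {X Y}, X < Y → G.deg X Y = 0 →
        G.dvol w y X Y = 0 ∧ G.hess w y y X Y = 0 := fun {X Y} h h0 => by
      have : G.rk Y = G.rk X + 1 := by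
        simp only [deg] at h0
        have : (G.rk Y : ℝ) = G.rk X + 1 := by linarith
        exact_mod_cast this
      exact ⟨G.dvol_of_rk_le w this.le y, G.hess_of_rk_le_two w (by omega) y y⟩
    have h2 := mul_mul_hessian_le (hdeg hF1) (hdeg hF2)
      (ih y A F hF1 (by omega)) (ih y F B hF2 (by omega)) (hdeg0 hF1) (hdeg0 hF2)
    rw [deg_add_deg] at h2
    have h3 : 0 < (G.deg A B - 1) * (G.vol w A F * G.vol w F B) :=
      mul_pos (by linarith) (mul_pos (hv hF1) (hv hF2))
    rw [mul_left_comm]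
    refine mul_le_mul_of_nonneg_left ?_ (hpos F hF1 hF2).le
    rw [← mul_div_assoc, le_div_iff₀ h3, hpair, dpair]
    linarith
  · rw [← hhess q w hqA hqB hA hB, hqw]

variable {w}

theorem deg_mul_vol_mul_hess_le (hw : G.Ample w) (u : P → ℝ) (A B : P) :
    G.deg A B * G.vol w A B * G.hess w u u A B ≤ (G.deg A B - 1) * G.dvol w u A B ^ 2 := by
  induction hn : G.rk B - G.rk A using Nat.strong_induction_on generalizing u A B with
  | _ n ih =>
  by_cases hAB : A < B
  swap
  · simp [G.vol_of_not_lt w hAB, dvol, fun F => G.vol_mul_vol_eq_zero w (not_between hAB F)]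
  have hlt := G.rk_lt hAB
  by_cases hr : G.rk B ≤ G.rk A + 2
  · rw [G.hess_of_rk_le_two w hr, mul_zero]
    rcases (by omega : G.rk B = G.rk A + 1 ∨ G.rk B = G.rk A + 2) with h | h
    · rw [G.dvol_of_rk_le w h.le]
      simp
    · rw [deg, h]
      push_cast
      ring_nf
      rfl
  have hd : 1 < G.deg A B := by
    have : (G.rk A : ℝ) + 3 ≤ G.rk B := by exact_mod_cast (by omega : G.rk A + 3 ≤ G.rk B)
    simp only [deg]
    linarith
  obtain ⟨v, c, m, hv, hA, hB, hpos⟩ := hw A B hAB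
  have hvol := G.vol_modular c m hv
  have hdvol : G.dvol v = G.dvol w := by
    funext y X Y
    simp only [dvol, hvol]
  have hhess : G.hess v = G.hess w := by
    funext y z X Y
    simp only [hess, dpair, hvol, hdvol]
  rw [← G.hess_nrm_self w hAB, ← G.dvol_nrm hAB (G.inv_all w A B), ← hvol, ← hdvol, ← hhess]
  refine G.deg_mul_vol_mul_hess_le_of_exists v hd (by rw [hvol]; exact G.vol_pos hw hAB) ?_
  by_cases hr3 : G.rk B = G.rk A + 3
  · exact G.exists_hess_nonpos_of_rk_three v hAB hr3 hA hB hpos (G.nrm_left hAB u)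
      (G.nrm_right hAB u)
  · refine G.exists_hess_nonpos_of_four_le v (by omega) hA hB hpos (G.nrm_left hAB u)
      (G.nrm_right hAB u) (fun {X Y} h => by rw [hvol]; exact G.vol_pos hw h) ?_
    intro y X Y _ hXY
    rw [hvol, hdvol, hhess]
    exact ih _ (by omega) y X Y rfl

end FlatSystem

namespace FlatSystem

open scoped Classical

variable {P E : Type*} [PartialOrder P] (G : FlatSystem P E)

lemma continuous_nrm {u : ℝ → P → ℝ} (hu : ∀ F, Continuous fun ε => u ε F) (A B F : P) :
    Continuous fun ε => G.nrm (u ε) A B F := by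
  have := hu A
  have := hu B
  have := hu F
  unfold nrm
  fun_prop

/-- The function `- 1_o`. -/
noncomputable def negSingle {Q : Type*} (o F : Q) : ℝ := if F = o then -1 else 0

lemma negSingle_self {Q : Type*} (o : Q) : negSingle o o = -1 := if_pos rfl

lemma negSingle_of_ne {Q : Type*} {o F : Q} (h : F ≠ o) : negSingle o F = 0 := if_neg h

lemma ample_perturbation {o : P} (ho : ∀ F, o ≤ F) {ε : ℝ} (hε : 0 < ε) :
    G.Ample fun F => negSingle o F - ε * ((G.pts F).card : ℝ) ^ 2 := by
  intro A B hAB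
  have hBo : B ≠ o := ((ho A).trans_lt hAB).ne'
  have hcard : ∀ {X Y : P}, X < Y → ((G.pts X).card : ℝ) < (G.pts Y).card := fun {X Y} h => by
    obtain ⟨i, hi, hi'⟩ := G.exists_mem_notMem h
    exact_mod_cast Finset.card_lt_card
      ((Finset.ssubset_iff_of_subset (G.le_iff.1 h.le)).2 ⟨i, hi, hi'⟩)
  by_cases hA : A = o
  · subst hA
    obtain ⟨k, hkB, hkA⟩ := G.exists_mem_notMem hAB
    refine ⟨_, 1 - ε * (G.pts A).card * (G.pts B).card,
      fun e => ε * ((G.pts A).card + (G.pts B).card) - if e = k then 1 else 0,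
      fun F => rfl, ?_, ?_, ?_⟩
    · simp only [Finset.sum_sub_distrib, Finset.sum_const, nsmul_eq_mul, Finset.sum_ite_eq',
        if_neg hkA, negSingle_self]
      ring
    · simp only [Finset.sum_sub_distrib, Finset.sum_const, nsmul_eq_mul, Finset.sum_ite_eq',
        if_pos hkB, negSingle_of_ne hBo]
      ring
    · intro F h1 h2
      have h3 := mul_pos hε (mul_pos (sub_pos.2 (hcard h1)) (sub_pos.2 (hcard h2)))
      simp only [Finset.sum_sub_distrib, Finset.sum_const, nsmul_eq_mul, Finset.sum_ite_eq',
        negSingle_of_ne ((ho A).trans_lt h1).ne']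
      split_ifs <;> nlinarith
  · refine ⟨_, - ε * (G.pts A).card * (G.pts B).card,
      fun e => ε * ((G.pts A).card + (G.pts B).card), fun F => rfl, ?_, ?_, ?_⟩
    · simp only [Finset.sum_const, nsmul_eq_mul, negSingle_of_ne hA]
      ring
    · simp only [Finset.sum_const, nsmul_eq_mul, negSingle_of_ne hBo]
      ring
    · intro F h1 h2
      have h3 := mul_pos hε (mul_pos (sub_pos.2 (hcard h1)) (sub_pos.2 (hcard h2)))
      simp only [Finset.sum_const, nsmul_eq_mul, negSingle_of_ne ((ho A).trans_lt h1).ne']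
      nlinarith

variable [Fintype P]

lemma continuous_vol {t : ℝ → P → ℝ} (ht : ∀ F, Continuous fun ε => t ε F) (A B : P) :
    Continuous fun ε => G.vol (t ε) A B := by
  induction hn : G.rk B - G.rk A using Nat.strong_induction_on generalizing A B with
  | _ n ih =>
  by_cases hAB : A < B
  swap
  · simp only [G.vol_of_not_lt _ hAB]
    exact continuous_const
  by_cases hr : G.rk B = G.rk A + 1
  · simp only [G.vol_of_cover _ hAB hr]
    exact continuous_const
  have hd : G.deg A B ≠ 0 := by
    intro h0
    apply hr
    have : (G.rk B : ℝ) = G.rk A + 1 := by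
      simp only [deg] at h0
      linarith
    exact_mod_cast this
  have h : ∀ ε, G.vol (t ε) A B = (G.deg A B)⁻¹ * G.dvol (t ε) (t ε) A B := fun ε => by
    rw [← deg_smul_vol, smul_eq_mul, inv_mul_cancel_left₀ hd]
  simp only [h, dvol]
  refine continuous_const.mul (continuous_finsetSum _ fun F _ =>
    (G.continuous_nrm ht A B F).mul ?_)
  by_cases hF : A < F ∧ F < B
  · have h1 := G.rk_lt hF.1
    have h2 := G.rk_lt hF.2
    exact (ih _ (by omega) A F rfl).mul (ih _ (by omega) F B rfl)
  · simp only [G.vol_mul_vol_eq_zero _ hF]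
    exact continuous_const

lemma continuous_dvol {t : ℝ → P → ℝ} (ht : ∀ F, Continuous fun ε => t ε F) (u : P → ℝ)
    (A B : P) : Continuous fun ε => G.dvol (t ε) u A B :=
  continuous_finsetSum _ fun _ _ =>
    continuous_const.mul ((G.continuous_vol ht _ _).mul (G.continuous_vol ht _ _))

lemma continuous_hess {t : ℝ → P → ℝ} (ht : ∀ F, Continuous fun ε => t ε F) (u v : P → ℝ)
    (A B : P) : Continuous fun ε => G.hess (t ε) u v A B :=
  continuous_finsetSum _ fun _ _ => continuous_const.mul
    (((G.continuous_dvol ht _ _ _).mul (G.continuous_vol ht _ _)).add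
      ((G.continuous_vol ht _ _).mul (G.continuous_dvol ht _ _ _)))

theorem deg_mul_vol_mul_hess_negSingle_le {o : P} (ho : ∀ F, o ≤ F) (u : P → ℝ) (A B : P) :
    G.deg A B * G.vol (negSingle o) A B * G.hess (negSingle o) u u A B ≤
      (G.deg A B - 1) * G.dvol (negSingle o) u A B ^ 2 := by
  set t : ℝ → P → ℝ := fun ε F => negSingle o F - ε * ((G.pts F).card : ℝ) ^ 2 with ht
  have hc : ∀ F, Continuous fun ε => t ε F := fun F => by
    simp only [ht]
    fun_prop
  have h0 : t 0 = negSingle o := by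
    funext F
    simp [ht]
  rw [← h0]
  have hf : Continuous fun ε =>
      G.deg A B * G.vol (t ε) A B * G.hess (t ε) u u A B :=
    (continuous_const.mul (G.continuous_vol hc A B)).mul (G.continuous_hess hc u u A B)
  have hg : Continuous fun ε => (G.deg A B - 1) * G.dvol (t ε) u A B ^ 2 :=
    continuous_const.mul ((G.continuous_dvol hc u A B).pow 2)
  refine le_of_tendsto_of_tendsto (b := nhdsWithin 0 (Set.Ioi 0))
    (hf.tendsto 0 |>.mono_left nhdsWithin_le_nhds)
    (hg.tendsto 0 |>.mono_left nhdsWithin_le_nhds) ?_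
  filter_upwards [self_mem_nhdsWithin] with ε hε
  exact G.deg_mul_vol_mul_hess_le (G.ample_perturbation ho hε) u A B

lemma vol_negSingle_of_ne {o A B : P} (ho : ∀ F, o ≤ F) (hA : A ≠ o) :
    G.vol (negSingle o) A B = if A < B ∧ G.rk B = G.rk A + 1 then 1 else 0 := by
  split_ifs with h
  · exact G.vol_of_cover _ h.1 h.2
  by_cases hAB : A < B
  swap
  · exact G.vol_of_not_lt _ hAB
  have hd : G.deg A B ≠ 0 := by
    intro h0
    apply h
    have : (G.rk B : ℝ) = G.rk A + 1 := by
      simp only [deg] at h0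
      linarith
    exact ⟨hAB, by exact_mod_cast this⟩
  apply mul_left_cancel₀ hd
  rw [mul_zero, ← smul_eq_mul, deg_smul_vol, ← G.dvol_const (negSingle o) 0 A B]
  exact G.dvol_congr _ fun F hF _ =>
    negSingle_of_ne (((ho A).lt_of_ne hA.symm).trans_le hF).ne'

lemma deg_mul_vol_negSingle {o B : P} (ho : ∀ F, o ≤ F) (hB : o < B) {j : E}
    (hj : j ∈ G.pts B) (hjo : j ∉ G.pts o) :
    G.deg o B * G.vol (negSingle o) o B =
      ∑ F with o < F ∧ F < B ∧ G.rk F + 1 = G.rk B ∧ j ∉ G.pts F, G.vol (negSingle o) o F := by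
  rw [← smul_eq_mul, deg_smul_vol, dvol_eq, negSingle_self, negSingle_of_ne hB.ne',
    Finset.sum_eq_zero]
  · have := G.sum_one_sub_ind_mul (G.inv_all (negSingle o) o B) hj
    rw [G.ind_of_notMem hjo, sub_zero, one_mul] at this
    rw [← this, Finset.sum_filter, zero_sub, zero_mul, sub_zero, neg_mul, one_mul, neg_neg]
    refine Finset.sum_congr rfl fun F _ => ?_
    split_ifs with h
    · rw [G.ind_of_notMem h.2.2.2, G.vol_of_cover _ h.2.1 h.2.2.1.symm]
      ring
    · by_cases hoF : o < F
      · rw [G.vol_negSingle_of_ne ho hoF.ne']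
        by_cases hjF : j ∈ G.pts F
        · rw [G.ind_of_mem hjF]
          ring
        · rw [if_neg fun h' => h ⟨hoF, h'.1, h'.2.symm, hjF⟩]
          ring
      · rw [G.vol_of_not_lt _ hoF]
        ring
  · intro F _
    by_cases hF : F = o
    · rw [hF, G.vol_of_not_lt _ (lt_irrefl o)]
      ring
    · rw [negSingle_of_ne hF, zero_mul]

/-- `b` satisfies the recursion of the absolute value of the Möbius function. -/
def WeisnerRec (o : P) (b : P → ℝ) : Prop :=
  b o = 1 ∧ ∀ B, o < B → ∀ j ∈ G.pts B, j ∉ G.pts o →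
    b B = ∑ F with F < B ∧ G.rk F + 1 = G.rk B ∧ j ∉ G.pts F, b F

lemma factorial_mul_vol_negSingle {o : P} {b : P → ℝ} (ho : ∀ F, o ≤ F)
    (hb : G.WeisnerRec o b) {n : ℕ} {B : P} (hB : o < B) (hn : G.rk B = G.rk o + n + 1) :
    (n.factorial : ℝ) * G.vol (negSingle o) o B = b B := by
  obtain ⟨j, hjB, hjo⟩ := G.exists_mem_notMem hB
  induction n generalizing B j with
  | zero =>
    rw [G.vol_of_cover _ hB hn, hb.2 B hB j hjB hjo, Finset.sum_eq_single o]
    · simp [hb.1]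
    · intro F hF hFo
      simp only [Finset.mem_filter] at hF
      have := G.rk_lt ((ho F).lt_of_ne' hFo)
      omega
    · intro h
      exact absurd (by simp [hB, hn, hjo]) h
  | succ n ih =>
    have hd : G.deg o B = (n + 1 : ℕ) := by
      rw [deg, hn]
      push_cast
      ring
    have h := G.deg_mul_vol_negSingle ho hB hjB hjo
    rw [hd] at h
    rw [Nat.factorial_succ, Nat.cast_mul, mul_comm (_ : ℝ) (n.factorial : ℝ), mul_assoc, h,
      Finset.mul_sum, hb.2 B hB j hjB hjo]
    have hoF : ∀ F, G.rk F + 1 = G.rk B → o < F := fun F h => (ho F).lt_of_ne fun h' => by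
      rw [← h'] at h
      omega
    refine Finset.sum_congr ?_ fun F hF => ?_
    · ext F
      simp only [Finset.mem_filter, Finset.mem_univ, true_and]
      exact ⟨fun h => h.2, fun h => ⟨hoF F h.2.1, h⟩⟩
    · simp only [Finset.mem_filter, Finset.mem_univ, true_and] at hF
      obtain ⟨i, hi, hi'⟩ := G.exists_mem_notMem (hoF F hF.2.1)
      exact ih (hoF F hF.2.1) (by omega) i hi hi'

theorem weisner_log_concave {o T : P} {b : P → ℝ} (ho : ∀ F, o ≤ F) (hb : G.WeisnerRec o b)
    {n : ℕ} (hT : o < T) (hn : G.rk T = G.rk o + n + 3) {j : E} (hj : j ∈ G.pts T)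
    (hjo : j ∉ G.pts o) :
    (∑ F with F < T ∧ G.rk F + 2 = G.rk T ∧ j ∈ G.pts F, b F) * b T ≤
      (∑ F with F < T ∧ G.rk F + 1 = G.rk T ∧ j ∈ G.pts F, b F) ^ 2 := by
  set β : P → ℝ := negSingle o with hβ
  set u : P → ℝ := fun F => G.ind ℝ j F + negSingle T F with hu
  have huo : u o = 0 := by simp [hu, G.ind_of_notMem hjo, negSingle_of_ne hT.ne]
  have huT : u T = 0 := by simp [hu, G.ind_of_mem hj, negSingle_self]
  have hlt : ∀ {F}, j ∈ G.pts F → o < F := fun {F} h =>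
    (ho F).lt_of_ne fun h' => hjo (h' ▸ h)
  have huF : ∀ {F}, F < T → u F = G.ind ℝ j F := fun {F} h => by
    simp [hu, negSingle_of_ne h.ne]
  have hd : G.deg o T = n + 2 := by
    rw [deg, hn]
    push_cast
    ring
  have h1 : G.dvol β u o T = ∑ F with F < T ∧ G.rk F + 1 = G.rk T ∧ j ∈ G.pts F, G.vol β o F := by
    rw [dvol, G.nrm_eq_self huo huT, Finset.sum_filter]
    refine Finset.sum_congr rfl fun F _ => ?_
    by_cases hF : o < F ∧ F < T
    · rw [huF hF.2, G.vol_negSingle_of_ne ho hF.1.ne', ind]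
      by_cases hjF : j ∈ G.pts F <;> simp [hjF, hF.2, eq_comm]
    · rw [G.vol_mul_vol_eq_zero _ hF, mul_zero]
      split_ifs with h
      · exact absurd ⟨hlt h.2.2, h.1⟩ hF
      · rfl
  have h2 : G.hess β u u o T =
      ∑ F with F < T ∧ G.rk F + 2 = G.rk T ∧ j ∈ G.pts F, G.vol β o F := by
    rw [hess, G.nrm_eq_self huo huT, Finset.sum_filter]
    refine Finset.sum_congr rfl fun F _ => ?_
    by_cases hF : o < F ∧ F < T
    · have e1 : G.dvol β u o F = 0 := by
        rw [← G.dvol_ind (G.inv_all β o F) j]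
        exact G.dvol_congr _ fun K _ hK => huF (hK.trans_lt hF.2)
      have e2 : G.dvol β u F T = G.svol β F T := by
        rw [hu, dvol_add, G.dvol_ind (G.inv_all β F T) j, dvol_eq, negSingle_self,
          negSingle_of_ne hF.2.ne, Finset.sum_eq_zero]
        · ring
        · intro K _
          by_cases hK : K = T
          · rw [hK, G.vol_of_not_lt _ (lt_irrefl T)]
            ring
          · rw [negSingle_of_ne hK, zero_mul]
      have e3 : G.svol β F T = if G.rk F + 2 = G.rk T then 1 else 0 := by
        split_ifs with h
        · exact G.svol_of_rk_two _ hF.2 h.symm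
        · refine Finset.sum_eq_zero fun K _ => ?_
          by_cases hK : F < K ∧ K < T
          · rw [G.vol_negSingle_of_ne ho hF.1.ne',
              G.vol_negSingle_of_ne ho (hF.1.trans hK.1).ne']
            by_cases h5 : G.rk K = G.rk F + 1
            · rw [if_neg (c := K < T ∧ _) fun h6 => h (by omega)]
              ring
            · rw [if_neg fun h6 => h5 h6.2]
              ring
          · rw [G.vol_mul_vol_eq_zero _ hK, mul_zero]
      rw [dpair, e1, e2, e3, huF hF.2, ind]
      by_cases hjF : j ∈ G.pts F <;> by_cases hr : G.rk F + 2 = G.rk T <;> simp [hjF, hF.2, hr]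
    · rw [G.dpair_eq_zero _ _ hF, mul_zero]
      split_ifs with h
      · exact absurd ⟨hlt h.2.2, h.1⟩ hF
      · rfl
  have h3 := G.factorial_mul_vol_negSingle ho hb hT (n := n + 2) (by omega)
  have h4 : ((n + 1).factorial : ℝ) * G.dvol β u o T =
      ∑ F with F < T ∧ G.rk F + 1 = G.rk T ∧ j ∈ G.pts F, b F := by
    rw [h1, Finset.mul_sum]
    refine Finset.sum_congr rfl fun F hF => ?_
    simp only [Finset.mem_filter, Finset.mem_univ, true_and] at hF
    exact G.factorial_mul_vol_negSingle ho hb (hlt hF.2.2) (by omega)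
  have h5 : (n.factorial : ℝ) * G.hess β u u o T =
      ∑ F with F < T ∧ G.rk F + 2 = G.rk T ∧ j ∈ G.pts F, b F := by
    rw [h2, Finset.mul_sum]
    refine Finset.sum_congr rfl fun F hF => ?_
    simp only [Finset.mem_filter, Finset.mem_univ, true_and] at hF
    exact G.factorial_mul_vol_negSingle ho hb (hlt hF.2.2) (by omega)
  have h6 := G.deg_mul_vol_mul_hess_negSingle_le ho u o T
  rw [hd] at h6
  rw [← h3, ← h4, ← h5, Nat.factorial_succ (n + 1), Nat.factorial_succ n]
  have h7 : 0 < ((n : ℝ) + 1) * (n.factorial : ℝ) ^ 2 := by positivity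
  have h8 := mul_le_mul_of_nonneg_left h6 h7.le
  push_cast
  rw [← hβ] at h8
  linarith

end FlatSystem

open scoped Classical in
/-- A closure operator on a finite set with a compatible rank function, in which the empty set
is closed. Closure in a loopless matroid is the motivating example. -/
structure RankedClosure (α : Type*) where
  /-- the ground set -/
  ground : Finset α
  /-- the closure operator -/
  cl : Finset α → Finset α
  /-- the rank function -/
  r : Finset α → ℕ
  subset_cl : ∀ {I}, I ⊆ ground → I ⊆ cl I
  cl_subset : ∀ I, cl I ⊆ ground
  cl_mono : ∀ {I J}, I ⊆ J → cl I ⊆ cl J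
  cl_cl : ∀ I, cl (cl I) = cl I
  cl_empty : cl ∅ = ∅
  r_cl : ∀ I, r (cl I) = r I
  r_empty : r ∅ = 0
  r_mono : ∀ {I J}, I ⊆ J → r I ≤ r J
  r_insert : ∀ {I j}, j ∈ ground → j ∉ cl I → r (insert j I) = r I + 1

namespace RankedClosure

open scoped Classical

variable {α : Type*} (C : RankedClosure α)

/-- The closed sets. -/
noncomputable def flats : Finset (Finset α) := {F ∈ C.ground.powerset | C.cl F = F}

lemma mem_flats {F : Finset α} : F ∈ C.flats ↔ C.cl F = F := by
  simp only [flats, Finset.mem_filter, Finset.mem_powerset, and_iff_right_iff_imp]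
  exact fun h => h ▸ C.cl_subset F

lemma subset_ground {F : Finset α} (hF : F ∈ C.flats) : F ⊆ C.ground :=
  C.mem_flats.1 hF ▸ C.cl_subset F

lemma cl_mem_flats (I : Finset α) : C.cl I ∈ C.flats := C.mem_flats.2 (C.cl_cl I)

lemma empty_mem_flats : ∅ ∈ C.flats := C.mem_flats.2 C.cl_empty

lemma ground_mem_flats : C.ground ∈ C.flats :=
  C.mem_flats.2 ((C.cl_subset _).antisymm (C.subset_cl subset_rfl))

lemma cl_subset_of_subset {I F : Finset α} (hF : F ∈ C.flats) (h : I ⊆ F) : C.cl I ⊆ F :=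
  C.mem_flats.1 hF ▸ C.cl_mono h

lemma r_lt {F K : Finset α} (hF : F ∈ C.flats) (hK : K ∈ C.flats) (h : F ⊂ K) :
    C.r F < C.r K := by
  obtain ⟨i, hi, hi'⟩ := Finset.exists_of_ssubset h
  have := C.r_insert (C.subset_ground hK hi) (by rwa [C.mem_flats.1 hF])
  have := C.r_mono (Finset.insert_subset hi h.subset)
  omega

lemma eq_of_subset_of_r_le {F K : Finset α} (hF : F ∈ C.flats) (hK : K ∈ C.flats) (h : F ⊆ K)
    (hr : C.r K ≤ C.r F) : F = K := by
  by_contra hne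
  exact absurd (C.r_lt hF hK (h.ssubset_of_ne hne)) (by omega)

lemma r_cl_insert {F : Finset α} {j : α} (hF : F ∈ C.flats) (hj : j ∈ C.ground) (hjF : j ∉ F) :
    C.r (C.cl (insert j F)) = C.r F + 1 := by
  rw [C.r_cl, C.r_insert hj (by rwa [C.mem_flats.1 hF])]

lemma insert_subset_cl {F : Finset α} {j : α} (hF : F ∈ C.flats) (hj : j ∈ C.ground) :
    insert j F ⊆ C.cl (insert j F) :=
  C.subset_cl (Finset.insert_subset hj (C.subset_ground hF))

/-- A cover of a flat is the closure of the flat with a point added. -/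
lemma cl_insert_eq {F K : Finset α} {j : α} (hF : F ∈ C.flats) (hK : K ∈ C.flats) (h : F ⊆ K)
    (hj : j ∈ K) (hjF : j ∉ F) (hr : C.r K ≤ C.r F + 1) : C.cl (insert j F) = K :=
  C.eq_of_subset_of_r_le (C.cl_mem_flats _) hK (C.cl_subset_of_subset hK
    (Finset.insert_subset hj h)) (by rwa [C.r_cl_insert hF (C.subset_ground hK hj) hjF])

/-- The absolute value of the Möbius function. -/
noncomputable def mob (F : Finset α) : ℝ :=
  (-1) ^ C.r F * ∑ I ∈ C.ground.powerset with C.cl I = F, (-1) ^ I.card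

lemma neg_one_pow_mul_mob (F : Finset α) :
    (-1) ^ C.r F * C.mob F = ∑ I ∈ C.ground.powerset with C.cl I = F, (-1) ^ I.card := by
  rw [mob, ← mul_assoc, ← mul_pow]
  simp

lemma mob_empty : C.mob ∅ = 1 := by
  rw [mob, C.r_empty, Finset.sum_eq_single ∅]
  · simp
  · intro I hI hne
    simp only [Finset.mem_filter, Finset.mem_powerset] at hI
    exact absurd (Finset.subset_empty.1 (hI.2 ▸ C.subset_cl hI.1)) hne
  · intro h
    exact absurd (by simp [C.cl_empty]) h

lemma cl_insert_cl {I : Finset α} (hI : I ⊆ C.ground) {j : α} (hj : j ∈ C.ground) :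
    C.cl (insert j (C.cl I)) = C.cl (insert j I) := by
  refine subset_antisymm (C.cl_subset_of_subset (C.cl_mem_flats _) (Finset.insert_subset ?_ ?_))
    (C.cl_mono (Finset.insert_subset_insert j (C.subset_cl hI)))
  · exact C.subset_cl (Finset.insert_subset hj hI) (Finset.mem_insert_self _ _)
  · exact C.cl_mono (Finset.subset_insert _ _)

lemma sum_cl_insert_eq_zero {F : Finset α} {j : α} (hj : j ∈ C.ground) :
    ∑ I ∈ C.ground.powerset with C.cl (insert j I) = F, (-1 : ℝ) ^ I.card = 0 := by
  refine Finset.sum_involution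
    (fun I _ => if j ∈ I then I.erase j else insert j I) ?_ ?_ ?_ ?_
  · intro I _
    split_ifs with h
    · rw [← Finset.card_erase_add_one h, pow_succ]
      ring
    · rw [Finset.card_insert_of_notMem h, pow_succ]
      ring
  · intro I _ _ h
    split_ifs at h with h'
    · exact Finset.notMem_erase j I (h.symm ▸ h')
    · exact h' (h ▸ Finset.mem_insert_self j I)
  · intro I hI
    simp only [Finset.mem_filter, Finset.mem_powerset] at hI ⊢
    split_ifs with h
    · exact ⟨(Finset.erase_subset _ _).trans hI.1, by
        rw [Finset.insert_erase h, ← hI.2, Finset.insert_eq_of_mem h]⟩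
    · exact ⟨Finset.insert_subset hj hI.1, by rw [Finset.insert_idem, hI.2]⟩
  · intro I _
    by_cases h : j ∈ I
    · simp [h]
    · simp [h]

/-- Weisner's theorem. -/
theorem mob_eq_sum {F : Finset α} (hF : F ∈ C.flats) {j : α} (hj : j ∈ F) :
    C.mob F = ∑ H ∈ C.flats with j ∉ H ∧ C.cl (insert j H) = F, C.mob H := by
  have hjE := C.subset_ground hF hj
  have h1 := C.sum_cl_insert_eq_zero (F := F) hjE
  have h2 : ∑ I ∈ C.ground.powerset with C.cl (insert j I) = F, (-1 : ℝ) ^ I.card =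
      ∑ I ∈ C.ground.powerset with C.cl I = F, (-1 : ℝ) ^ I.card +
      ∑ I ∈ C.ground.powerset with j ∉ C.cl I ∧ C.cl (insert j I) = F, (-1 : ℝ) ^ I.card := by
    rw [← Finset.sum_union]
    · refine Finset.sum_congr ?_ fun _ _ => rfl
      ext I
      simp only [Finset.mem_union, Finset.mem_filter, Finset.mem_powerset, ← and_or_left,
        and_congr_right_iff]
      intro hI
      have h3 : j ∈ C.cl I → C.cl (insert j I) = C.cl I := fun h => by
        rw [← C.cl_insert_cl hI hjE, Finset.insert_eq_of_mem h, C.cl_cl]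
      constructor
      · intro h
        by_cases h' : j ∈ C.cl I
        · exact Or.inl (by rw [← h3 h', h])
        · exact Or.inr ⟨h', h⟩
      · rintro (h | h)
        · rw [h3 (h ▸ hj), h]
        · exact h.2
    · refine Finset.disjoint_left.2 fun I h h' => ?_
      simp only [Finset.mem_filter] at h h'
      exact h'.2.1 (h.2 ▸ hj)
  have h3 : ∑ I ∈ C.ground.powerset with j ∉ C.cl I ∧ C.cl (insert j I) = F,
      (-1 : ℝ) ^ I.card = ∑ H ∈ C.flats with j ∉ H ∧ C.cl (insert j H) = F,
        (-1) ^ C.r H * C.mob H := by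
    rw [← Finset.sum_fiberwise_of_maps_to
      (t := {H ∈ C.flats | j ∉ H ∧ C.cl (insert j H) = F}) (g := C.cl)]
    · refine Finset.sum_congr rfl fun H hH => ?_
      rw [neg_one_pow_mul_mob, Finset.filter_filter]
      simp only [Finset.mem_filter] at hH
      refine Finset.sum_congr (Finset.filter_congr fun I hI => ?_) fun _ _ => rfl
      refine ⟨fun h => h.2, fun h => ⟨⟨h ▸ hH.2.1, ?_⟩, h⟩⟩
      rw [← C.cl_insert_cl (Finset.mem_powerset.1 hI) hjE, h, hH.2.2]
    · intro I hI
      simp only [Finset.mem_filter, Finset.mem_powerset] at hI ⊢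
      exact ⟨C.cl_mem_flats I, hI.2.1, by rw [C.cl_insert_cl hI.1 hjE, hI.2.2]⟩
  rw [h2, h3] at h1
  rw [mob, eq_neg_of_add_eq_zero_left h1, ← Finset.sum_neg_distrib, Finset.mul_sum]
  refine Finset.sum_congr rfl fun H hH => ?_
  simp only [Finset.mem_filter] at hH
  rw [← hH.2.2, C.r_cl_insert hH.1 hjE hH.2.1, pow_succ]
  have : ((-1 : ℝ) ^ C.r H) * (-1) ^ C.r H = 1 := by
    rw [← mul_pow]
    simp
  linear_combination (C.mob H) * this

lemma exists_complement {F : Finset α} (hF : F ∈ C.flats) {j : α} (hj : j ∈ F) :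
    ∃ H ∈ C.flats, H ⊆ F ∧ j ∉ H ∧ C.cl (insert j H) = F := by
  obtain ⟨H, hH, hmax⟩ := Finset.exists_max_image {H ∈ C.flats | H ⊆ F ∧ j ∉ H} Finset.card
    ⟨∅, by simp [C.empty_mem_flats]⟩
  simp only [Finset.mem_filter] at hH hmax
  refine ⟨H, hH.1, hH.2.1, hH.2.2, ?_⟩
  have hjE := C.subset_ground hF hj
  refine subset_antisymm (C.cl_subset_of_subset hF (Finset.insert_subset hj hH.2.1)) ?_
  intro i hi
  by_contra hi'
  have hiE := C.subset_ground hF hi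
  have hiH : i ∉ H := fun h => hi' (C.insert_subset_cl hH.1 hjE (Finset.mem_insert_of_mem h))
  have hsub := C.insert_subset_cl hH.1 hiE
  have hjmem : j ∈ C.cl (insert i H) := by
    by_contra hjn
    have h1 := hmax (C.cl (insert i H)) ⟨C.cl_mem_flats _,
      C.cl_subset_of_subset hF (Finset.insert_subset hi hH.2.1), hjn⟩
    have h2 := Finset.card_le_card hsub
    rw [Finset.card_insert_of_notMem hiH] at h2
    omega
  have := C.cl_insert_eq hH.1 (C.cl_mem_flats (insert i H))
    ((Finset.subset_insert _ _).trans hsub) hjmem hH.2.2 (C.r_cl_insert hH.1 hiE hiH).le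
  exact hi' (this ▸ hsub (Finset.mem_insert_self _ _))

lemma mob_pos {F : Finset α} (hF : F ∈ C.flats) : 0 < C.mob F := by
  induction hn : C.r F using Nat.strong_induction_on generalizing F with
  | _ n ih =>
  rcases F.eq_empty_or_nonempty with rfl | ⟨j, hj⟩
  · rw [mob_empty]
    exact one_pos
  · rw [C.mob_eq_sum hF hj]
    obtain ⟨H, h1, h2, h3, h4⟩ := C.exists_complement hF hj
    refine Finset.sum_pos (fun K hK => ?_) ⟨H, by simp [h1, h3, h4]⟩
    simp only [Finset.mem_filter] at hK
    have := C.r_cl_insert hK.1 (C.subset_ground hF hj) hK.2.1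
    rw [hK.2.2] at this
    exact ih _ (by omega) hK.1 rfl

/-- The `k`-th unsigned Whitney number of the first kind. -/
noncomputable def whitney (k : ℕ) : ℝ := ∑ F ∈ C.flats with C.r F = k, C.mob F

/-- The contribution to `whitney k` of the flats avoiding `j`. -/
noncomputable def avoid (j : α) (k : ℕ) : ℝ := ∑ F ∈ C.flats with C.r F = k ∧ j ∉ F, C.mob F

variable {C}

lemma sum_mem_eq_avoid {j : α} (hj : j ∈ C.ground) (k : ℕ) :
    ∑ F ∈ C.flats with C.r F = k + 1 ∧ j ∈ F, C.mob F = C.avoid j k := by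
  rw [avoid, ← Finset.sum_fiberwise_of_maps_to (s := {F ∈ C.flats | C.r F = k ∧ j ∉ F})
    (t := {F ∈ C.flats | C.r F = k + 1 ∧ j ∈ F}) (g := fun H => C.cl (insert j H))]
  · refine Finset.sum_congr rfl fun F hF => ?_
    simp only [Finset.mem_filter] at hF
    rw [C.mob_eq_sum hF.1 hF.2.2, Finset.filter_filter]
    refine Finset.sum_congr (Finset.filter_congr fun H hH => ?_) fun _ _ => rfl
    refine ⟨fun h => ⟨⟨?_, h.1⟩, h.2⟩, fun h => ⟨h.1.2, h.2⟩⟩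
    have := C.r_cl_insert hH hj h.1
    rw [h.2] at this
    omega
  · intro H hH
    simp only [Finset.mem_filter] at hH ⊢
    exact ⟨C.cl_mem_flats _, by rw [C.r_cl_insert hH.1 hj hH.2.2, hH.2.1],
      C.insert_subset_cl hH.1 hj (Finset.mem_insert_self _ _)⟩

lemma r_eq_zero {F : Finset α} (hF : F ∈ C.flats) (h : C.r F = 0) : F = ∅ :=
  (C.eq_of_subset_of_r_le C.empty_mem_flats hF (Finset.empty_subset F) (by omega)).symm

lemma whitney_zero : C.whitney 0 = 1 := by
  rw [whitney, Finset.sum_eq_single ∅, C.mob_empty]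
  · intro F hF hne
    simp only [Finset.mem_filter] at hF
    exact absurd (r_eq_zero hF.1 hF.2) hne
  · intro h
    exact absurd (by simp [C.empty_mem_flats, C.r_empty]) h

lemma avoid_zero (j : α) : C.avoid j 0 = 1 := by
  rw [avoid, Finset.sum_eq_single ∅, C.mob_empty]
  · intro F hF hne
    simp only [Finset.mem_filter] at hF
    exact absurd (r_eq_zero hF.1 hF.2.1) hne
  · intro h
    exact absurd (by simp [C.empty_mem_flats, C.r_empty]) h

lemma whitney_succ {j : α} (hj : j ∈ C.ground) (k : ℕ) :
    C.whitney (k + 1) = C.avoid j (k + 1) + C.avoid j k := by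
  rw [← sum_mem_eq_avoid hj k, whitney, avoid, add_comm (Finset.sum _ _), ← Finset.sum_filter_add_sum_filter_not
    ({F ∈ C.flats | C.r F = k + 1}) (fun F => j ∈ F), Finset.filter_filter, Finset.filter_filter]

lemma avoid_eq_avoid {i j : α} (hi : i ∈ C.ground) (hj : j ∈ C.ground) (k : ℕ) :
    C.avoid i k = C.avoid j k := by
  induction k with
  | zero => rw [avoid_zero, avoid_zero]
  | succ k ih =>
    have h1 := whitney_succ hi k
    have h2 := whitney_succ hj k
    linarith

lemma whitney_nonneg (k : ℕ) : 0 ≤ C.whitney k :=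
  Finset.sum_nonneg fun _ hF => (C.mob_pos (Finset.mem_filter.1 hF).1).le

lemma avoid_nonneg (j : α) (k : ℕ) : 0 ≤ C.avoid j k :=
  Finset.sum_nonneg fun _ hF => (C.mob_pos (Finset.mem_filter.1 hF).1).le

lemma exists_flat_avoiding {j : α} (hj : j ∈ C.ground) {k : ℕ} (hk : k + 1 ≤ C.r C.ground) :
    ∃ F ∈ C.flats, C.r F = k ∧ j ∉ F := by
  obtain ⟨m, hm⟩ := Nat.exists_eq_add_of_le hk
  induction m generalizing k with
  | zero =>
    obtain ⟨H, h1, -, h3, h4⟩ := C.exists_complement C.ground_mem_flats hj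
    have := C.r_cl_insert h1 hj h3
    rw [h4] at this
    exact ⟨H, h1, by omega, h3⟩
  | succ m ih =>
    obtain ⟨F, h1, h2, h3⟩ := ih (k := k + 1) (by omega) (by omega)
    obtain ⟨i, hi⟩ : F.Nonempty := by
      rw [Finset.nonempty_iff_ne_empty]
      rintro rfl
      rw [C.r_empty] at h2
      omega
    obtain ⟨H, g1, g2, g3, g4⟩ := C.exists_complement h1 hi
    have := C.r_cl_insert g1 (C.subset_ground h1 hi) g3
    rw [g4] at this
    exact ⟨H, g1, by omega, fun h => h3 (g2 h)⟩

lemma avoid_pos {j : α} (hj : j ∈ C.ground) {k : ℕ} (hk : k + 1 ≤ C.r C.ground) :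
    0 < C.avoid j k := by
  obtain ⟨F, h1, h2, h3⟩ := exists_flat_avoiding hj hk
  exact Finset.sum_pos (fun _ hF => C.mob_pos (Finset.mem_filter.1 hF).1)
    ⟨F, by simp [h1, h2, h3]⟩

lemma avoid_rank {j : α} (hj : j ∈ C.ground) : C.avoid j (C.r C.ground) = 0 := by
  rw [avoid, Finset.filter_eq_empty_iff.2, Finset.sum_empty]
  rintro F hF ⟨h, hjF⟩
  rw [C.eq_of_subset_of_r_le hF C.ground_mem_flats (C.subset_ground hF) h.ge] at hjF
  exact hjF hj

end RankedClosure

namespace RankedClosure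

open scoped Classical

variable {α : Type*} (C : RankedClosure α)

/-- The flats of rank at most `k + 1`, together with the ground set. -/
noncomputable def truncFlats (k : ℕ) : Finset (Finset α) :=
  {F ∈ C.flats | C.r F ≤ k + 1 ∨ F = C.ground}

lemma mem_truncFlats {k : ℕ} {F : Finset α} :
    F ∈ C.truncFlats k ↔ F ∈ C.flats ∧ (C.r F ≤ k + 1 ∨ F = C.ground) := by
  rw [truncFlats, Finset.mem_filter]

/-- The lattice of flats of the truncation to rank `k + 2`. -/
noncomputable def truncation (k : ℕ) : FlatSystem (C.truncFlats k) α where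
  pts F := F
  rk F := min (C.r F) (k + 2)
  le_iff := Iff.rfl
  rk_lt {A B} h := by
    have hA := C.mem_truncFlats.1 A.2
    have hB := C.mem_truncFlats.1 B.2
    have h1 := C.r_lt hA.1 hB.1 h
    have h2 : C.r A ≤ k + 1 := hA.2.resolve_right fun h' =>
      h.not_ge (show (B : Finset α) ⊆ A from h' ▸ C.subset_ground hB.1)
    omega
  existsUnique_cover {A B i} h hiB hiA := by
    have hA := C.mem_truncFlats.1 A.2
    have hB := C.mem_truncFlats.1 B.2
    have hiE := C.subset_ground hB.1 hiB
    have h1 := C.r_lt hA.1 hB.1 h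
    have h2 : C.r A ≤ k + 1 := hA.2.resolve_right fun h' =>
      h.not_ge (show (B : Finset α) ⊆ A from h' ▸ C.subset_ground hB.1)
    have hlt : ∀ {F : C.truncFlats k}, A < F → C.r A < C.r F := fun {F} hF =>
      C.r_lt hA.1 (C.mem_truncFlats.1 F.2).1 hF
    by_cases h3 : C.r A = k + 1
    · have htop : ∀ F : C.truncFlats k, A < F → (F : Finset α) = C.ground := fun F hF =>
        (C.mem_truncFlats.1 F.2).2.resolve_left (by have := hlt hF; omega)
      refine ⟨B, ⟨h, le_rfl, hiB, by omega⟩, fun F hF => Subtype.ext ?_⟩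
      rw [htop F hF.1, htop B h]
    · have hr := C.r_cl_insert hA.1 hiE hiA
      have hsub := C.insert_subset_cl hA.1 hiE
      refine ⟨⟨C.cl (insert i A), C.mem_truncFlats.2 ⟨C.cl_mem_flats _, Or.inl (by omega)⟩⟩,
        ⟨?_, ?_, hsub (Finset.mem_insert_self _ _), ?_⟩, fun F hF => Subtype.ext ?_⟩
      · exact lt_of_le_of_ne (show (A : Finset α) ⊆ C.cl (insert i A) from
          (Finset.subset_insert _ _).trans hsub)
          fun h' => hiA (congrArg Subtype.val h' ▸ hsub (Finset.mem_insert_self _ _))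
      · exact C.cl_subset_of_subset hB.1 (Finset.insert_subset hiB h.le)
      · simp only
        omega
      · have := hF.2.2.2
        exact (C.cl_insert_eq hA.1 (C.mem_truncFlats.1 F.2).1 hF.1.le hF.2.2.1 hiA
          (by omega)).symm

variable {C}

lemma sum_truncFlats {k : ℕ} (hk : k + 2 ≤ C.r C.ground) (a : ℝ) (p : C.truncFlats k → Prop)
    (q : Finset α → Prop) [DecidablePred p] [DecidablePred q] (hq : ∀ F ∈ C.flats, q F → C.r F ≤ k + 1)
    (hpq : ∀ F : C.truncFlats k, p F ↔ q F) :
    ∑ F : C.truncFlats k with p F, (if (F : Finset α) = C.ground then a else C.mob F) =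
      ∑ F ∈ C.flats with q F, C.mob F := by
  simp only [hpq]
  rw [Finset.sum_filter, Finset.sum_coe_sort (C.truncFlats k) (fun F : Finset α =>
    if q F then (if F = C.ground then a else C.mob F) else 0), ← Finset.sum_filter]
  refine Finset.sum_congr ?_ fun F hF => ?_
  · ext F
    simp only [Finset.mem_filter, mem_truncFlats]
    exact ⟨fun h => ⟨h.1.1, h.2⟩, fun h => ⟨⟨h.1, Or.inl (hq F h.1 h.2)⟩, h.2⟩⟩
  · simp only [Finset.mem_filter] at hF
    rw [if_neg]
    rintro rfl
    have := hq _ hF.1 hF.2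
    omega

theorem avoid_log_concave {j : α} (hj : j ∈ C.ground) {n : ℕ} (hn : n + 3 ≤ C.r C.ground) :
    C.avoid j n * C.avoid j (n + 2) ≤ C.avoid j (n + 1) ^ 2 := by
  set G := C.truncation (n + 1) with hG
  have h0 : ∅ ∈ C.truncFlats (n + 1) :=
    C.mem_truncFlats.2 ⟨C.empty_mem_flats, Or.inl (by rw [C.r_empty]; omega)⟩
  have h1 : C.ground ∈ C.truncFlats (n + 1) :=
    C.mem_truncFlats.2 ⟨C.ground_mem_flats, Or.inr rfl⟩
  set o : C.truncFlats (n + 1) := ⟨∅, h0⟩ with ho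
  set T : C.truncFlats (n + 1) := ⟨C.ground, h1⟩ with hT
  set b : C.truncFlats (n + 1) → ℝ := fun F =>
    if (F : Finset α) = C.ground then C.avoid j (n + 2) else C.mob F with hb
  have hoF : ∀ F, o ≤ F := fun F => Finset.empty_subset _
  have hFT : ∀ F, F ≤ T := fun F => C.subset_ground (C.mem_truncFlats.1 F.2).1
  have hlt : ∀ F : C.truncFlats (n + 1), F < T ↔ (F : Finset α) ≠ C.ground := fun F =>
    ⟨fun h h' => h.ne (Subtype.ext h'), fun h => (hFT F).lt_of_ne fun h' => h (by rw [h'])⟩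
  have hrk : ∀ F : C.truncFlats (n + 1), G.rk F = min (C.r F) (n + 3) := fun F => rfl
  have hrT : G.rk T = n + 3 := min_eq_right hn
  have hro : G.rk o = 0 := by
    rw [hrk, ho]
    simp [C.r_empty]
  have hsmall : ∀ F : C.truncFlats (n + 1), C.r F ≤ n + 2 → F < T := fun F h => by
    rw [hlt]
    intro h'
    rw [h'] at h
    omega
  have hE : C.ground ≠ ∅ := fun h => by
    rw [h] at hj
    exact Finset.notMem_empty _ hj
  have hsum : ∀ (p : C.truncFlats (n + 1) → Prop) (q : Finset α → Prop) {_ : DecidablePred p}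
      {_ : DecidablePred q}, (∀ F ∈ C.flats, q F → C.r F ≤ n + 2) → (∀ F, p F ↔ q F) →
      ∑ F with p F, b F = ∑ F ∈ C.flats with q F, C.mob F :=
    fun p q _ _ => sum_truncFlats hn _ p q
  have hrec : G.WeisnerRec o b := by
    refine ⟨?_, fun B hB i hi _ => ?_⟩
    · simp only [hb, ho]
      rw [if_neg (Ne.symm hE), C.mob_empty]
    by_cases hBE : (B : Finset α) = C.ground
    · have hBT : B = T := Subtype.ext hBE
      have hiE : i ∈ C.ground := hBE ▸ hi
      rw [hsum _ (fun F => C.r F = n + 2 ∧ i ∉ F)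
        (fun F _ h => h.1.le)]
      · simp only [hb, if_pos hBE]
        exact avoid_eq_avoid hj hiE _
      · intro F
        rw [hBT, hrT, hrk]
        constructor
        · rintro ⟨_, h3, h4⟩
          exact ⟨by omega, h4⟩
        · rintro ⟨h3, h4⟩
          exact ⟨hsmall F h3.le, by omega, h4⟩
    · have hB' := C.mem_truncFlats.1 B.2
      have hrB := hB'.2.resolve_right hBE
      rw [hsum _ (fun F => i ∉ F ∧ C.cl (insert i F) = B)]
      · simp only [hb, if_neg hBE]
        exact C.mob_eq_sum hB'.1 hi
      · intro F hF h
        have := C.r_cl_insert hF (C.subset_ground hB'.1 hi) h.1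
        rw [h.2] at this
        omega
      · intro F
        have hF' := C.mem_truncFlats.1 F.2
        rw [hrk, hrk]
        constructor
        · rintro ⟨h2, h3, h4⟩
          exact ⟨h4, C.cl_insert_eq hF'.1 hB'.1 h2.le hi h4 (by omega)⟩
        · rintro ⟨h2, h3⟩
          have h4 := C.r_cl_insert hF'.1 (C.subset_ground hB'.1 hi) h2
          have h5 : (F : Finset α) ⊆ B := h3 ▸ (Finset.subset_insert _ _).trans
            (C.insert_subset_cl hF'.1 (C.subset_ground hB'.1 hi))
          rw [h3] at h4
          exact ⟨lt_of_le_of_ne h5 fun h => h2 (h ▸ hi), by omega, h2⟩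
  have hoT : o < T := (hoF T).lt_of_ne fun h => hE (congrArg Subtype.val h).symm
  have key := G.weisner_log_concave hoF hrec hoT (n := n) (j := j) (by omega) hj
    (Finset.notMem_empty _)
  have e1 : b T = C.avoid j (n + 2) := if_pos rfl
  rw [e1, hsum _ (fun F => C.r F = n + 1 ∧ j ∈ F)
      (fun F _ h => by omega),
    hsum _ (fun F => C.r F = n + 1 + 1 ∧ j ∈ F)
      (fun F _ h => by omega), sum_mem_eq_avoid hj, sum_mem_eq_avoid hj] at key
  · exact key
  · intro F
    rw [hrT, hrk]
    constructor
    · rintro ⟨_, h3, h4⟩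
      exact ⟨by omega, h4⟩
    · rintro ⟨h3, h4⟩
      exact ⟨hsmall F h3.le, by omega, h4⟩
  · intro F
    rw [hrT, hrk]
    constructor
    · rintro ⟨_, h3, h4⟩
      exact ⟨by omega, h4⟩
    · rintro ⟨h3, h4⟩
      exact ⟨hsmall F (by omega), by omega, h4⟩

lemma avoid_log_concave' {j : α} (hj : j ∈ C.ground) {n : ℕ} (hn : n + 2 ≤ C.r C.ground) :
    C.avoid j n * C.avoid j (n + 2) ≤ C.avoid j (n + 1) ^ 2 := by
  rcases hn.eq_or_lt with h | h
  · rw [h, avoid_rank hj, mul_zero]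
    positivity
  · exact avoid_log_concave hj h

theorem whitney_log_concave {n : ℕ} (hn : n + 2 ≤ C.r C.ground) :
    C.whitney n * C.whitney (n + 2) ≤ C.whitney (n + 1) ^ 2 := by
  obtain ⟨j, hj⟩ : C.ground.Nonempty := by
    rw [Finset.nonempty_iff_ne_empty]
    intro h
    rw [h, C.r_empty] at hn
    omega
  have h1 := avoid_log_concave' hj hn
  have p1 := avoid_pos hj (k := n + 1) hn
  have p2 := avoid_nonneg (C := C) j (n + 2)
  rw [whitney_succ hj (n + 1), whitney_succ hj n]
  cases n with
  | zero =>
    rw [whitney_zero]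
    rw [avoid_zero] at h1 ⊢
    nlinarith
  | succ n =>
    have h2 := avoid_log_concave' hj (n := n) (by omega)
    have p3 := avoid_pos hj (k := n + 1) (by omega)
    have p4 := avoid_nonneg (C := C) j n
    have h3 : C.avoid j n * C.avoid j (n + 3) ≤ C.avoid j (n + 1) * C.avoid j (n + 2) := by
      refine le_of_mul_le_mul_left ?_ (mul_pos p3 p1)
      have := mul_le_mul h2 h1 (mul_nonneg p3.le p2) (sq_nonneg _)
      nlinarith
    rw [whitney_succ hj n]
    simp only [add_assoc, Nat.reduceAdd] at *
    nlinarith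

end RankedClosure

namespace RankedClosure

open scoped Classical

variable {α : Type*} {C : RankedClosure α}

theorem sum_powerset_eq_sum_whitney (x : ℝ) :
    ∑ I ∈ C.ground.powerset, (-1 : ℝ) ^ I.card * x ^ (C.r C.ground - C.r I) =
      ∑ k ∈ Finset.range (C.r C.ground + 1),
        (-1 : ℝ) ^ k * C.whitney k * x ^ (C.r C.ground - k) := by
  have h1 : ∑ I ∈ C.ground.powerset, (-1 : ℝ) ^ I.card * x ^ (C.r C.ground - C.r I) =
      ∑ F ∈ C.flats, (-1 : ℝ) ^ C.r F * C.mob F * x ^ (C.r C.ground - C.r F) := by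
    rw [← Finset.sum_fiberwise_of_maps_to (g := C.cl) (t := C.flats)
      fun I _ => C.cl_mem_flats I]
    refine Finset.sum_congr rfl fun F _ => ?_
    rw [neg_one_pow_mul_mob, Finset.sum_mul]
    refine Finset.sum_congr rfl fun I hI => ?_
    rw [← (Finset.mem_filter.1 hI).2, C.r_cl]
  rw [h1, ← Finset.sum_fiberwise_of_maps_to (g := C.r) (t := Finset.range (C.r C.ground + 1))
    fun F hF => Finset.mem_range.2 (Nat.lt_succ_of_le (C.r_mono (C.subset_ground hF)))]
  refine Finset.sum_congr rfl fun k _ => ?_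
  rw [whitney, Finset.mul_sum, Finset.sum_mul]
  refine Finset.sum_congr rfl fun F hF => ?_
  rw [(Finset.mem_filter.1 hF).2]

end RankedClosure

/-- Coefficients of a polynomial function, read from the top, are unique. -/
lemma eq_of_sum_mul_pow_sub_eq {n : ℕ} {a b : ℕ → ℝ}
    (h : ∀ x : ℝ, ∑ k ∈ Finset.range (n + 1), a k * x ^ (n - k) =
      ∑ k ∈ Finset.range (n + 1), b k * x ^ (n - k)) {k : ℕ} (hk : k ≤ n) : a k = b k := by
  have hp : ∑ k ∈ Finset.range (n + 1), Polynomial.C (a k) * Polynomial.X ^ (n - k) =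
      ∑ k ∈ Finset.range (n + 1), Polynomial.C (b k) * Polynomial.X ^ (n - k) :=
    Polynomial.funext fun x => by simpa [Polynomial.eval_finsetSum] using h x
  have hc : ∀ c : ℕ → ℝ, (∑ k ∈ Finset.range (n + 1),
      Polynomial.C (c k) * Polynomial.X ^ (n - k)).coeff (n - k) = c k := fun c => by
    simp only [Polynomial.finsetSum_coeff, Polynomial.coeff_C_mul, Polynomial.coeff_X_pow]
    rw [Finset.sum_eq_single k]
    · simp
    · intro i hi hik
      rw [if_neg, mul_zero]
      have := Finset.mem_range.1 hi
      omega
    · intro h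
      exact absurd (Finset.mem_range.2 (Nat.lt_succ_of_le hk)) h
  rw [← hc a, hp, hc b]

section

variable {α : Type*} {M : Matroid α}

lemma eRk_ne_top_of_ground_finite (hE : M.E.Finite) (A : Set α) : M.eRk A ≠ ⊤ := by
  rw [← M.eRk_inter_ground]
  exact ne_top_of_le_ne_top (hE.subset Set.inter_subset_right).encard_lt_top.ne
    (M.eRk_le_encard _)

lemma matroidRank_eq_eRk (hE : M.E.Finite) (A : Set α) : (matroidRank M A : ℕ∞) = M.eRk A := by
  obtain ⟨n, hn⟩ := ENat.ne_top_iff_exists.1 (eRk_ne_top_of_ground_finite hE A)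
  have hfin : ∀ I, M.Indep I → (I.ncard : ℕ∞) = I.encard := fun I hI =>
    (hE.subset hI.subset_ground).cast_ncard_eq
  rw [← hn, Nat.cast_inj]
  refine IsGreatest.csSup_eq ⟨?_, ?_⟩
  · obtain ⟨I, hIA, hI, hIn⟩ := Matroid.le_eRk_iff.1 hn.le
    refine ⟨I, hIA, hI, ?_⟩
    rw [← hfin I hI] at hIn
    exact_mod_cast hIn
  · rintro _ ⟨I, hIA, hI, rfl⟩
    have := hI.encard_le_eRk_of_subset hIA
    rw [← hfin I hI, ← hn] at this
    exact_mod_cast this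

open scoped Classical in
/-- The closure operator of a loopless matroid on a finite ground set. -/
noncomputable def rankedClosureOfMatroid (M : Matroid α) (hE : M.E.Finite)
    (hM : ∀ e ∈ M.E, M.Indep {e}) : RankedClosure α :=
  have hcoe : ∀ I : Finset α,
      (({e ∈ hE.toFinset | e ∈ M.closure I} : Finset α) : Set α) = M.closure I := fun I => by
    ext e
    simpa using fun h => M.mem_ground_of_mem_closure h
  { ground := hE.toFinset
    cl I := {e ∈ hE.toFinset | e ∈ M.closure I}
    r I := matroidRank M I
    subset_cl {I} h e he := Finset.mem_filter.2 ⟨h he,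
      M.subset_closure (I : Set α) (fun x hx => hE.mem_toFinset.1 (h hx)) he⟩
    cl_subset I := Finset.filter_subset _ _
    cl_mono h := Finset.monotone_filter_right _ fun e _ he =>
      M.closure_subset_closure (Finset.coe_subset.2 h) he
    cl_cl I := by
      rw [hcoe, M.closure_closure]
    cl_empty := by
      refine Finset.filter_eq_empty_iff.2 fun e he h => ?_
      rw [Finset.coe_empty] at h
      exact ((M.indep_singleton.1 (hM e (hE.mem_toFinset.1 he))).not_isLoop) h
    r_cl I := by
      rw [← Nat.cast_inj (R := ℕ∞), matroidRank_eq_eRk hE, matroidRank_eq_eRk hE, hcoe,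
        M.eRk_closure_eq]
    r_empty := by
      rw [← Nat.cast_inj (R := ℕ∞), matroidRank_eq_eRk hE, Finset.coe_empty, M.eRk_empty,
        Nat.cast_zero]
    r_mono h := by
      rw [← Nat.cast_le (α := ℕ∞), matroidRank_eq_eRk hE, matroidRank_eq_eRk hE]
      exact M.eRk_mono (Finset.coe_subset.2 h)
    r_insert {I j} hj h := by
      rw [← Nat.cast_inj (R := ℕ∞), matroidRank_eq_eRk hE, Nat.cast_add, matroidRank_eq_eRk hE,
        Finset.coe_insert, Nat.cast_one]
      exact M.eRk_insert_eq_add_one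
        ⟨hE.mem_toFinset.1 hj, fun h' => h (Finset.mem_filter.2 ⟨hj, h'⟩)⟩ }

end

/-- **Adiprasito–Huh–Katz** (conjectured by Heron, Rota, and Welsh).  Let `M` be a loopless
matroid of rank `r` on a finite ground set `E` with rank function `r(·)`, and write its
characteristic polynomial as
`χ_M(λ) = Σ_{I ⊆ E} (−1)^{|I|} λ^{r(E) − r(I)} = Σ_{k=0}^{r} (−1)^k w_k λ^{r−k}`.
Then each `w_k` is nonnegative and the sequence `(w_0, …, w_r)` is log-concave:
`w_k² ≥ w_{k−1} · w_{k+1}` for all `1 ≤ k ≤ r − 1`. -/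
theorem whitney_numbers_log_concave {α : Type*} (M : Matroid α) (hE : M.E.Finite)
    (hloopless : ∀ e ∈ M.E, M.Indep {e})
    (w : ℕ → ℝ)
    (hw : ∀ x : ℝ,
      ∑ I ∈ hE.toFinset.powerset,
          (-1 : ℝ) ^ I.card * x ^ (matroidRank M M.E - matroidRank M (I : Set α)) =
        ∑ k ∈ Finset.range (matroidRank M M.E + 1),
          (-1 : ℝ) ^ k * w k * x ^ (matroidRank M M.E - k)) :
    (∀ k : ℕ, k ≤ matroidRank M M.E → 0 ≤ w k) ∧
      ∀ k : ℕ, 1 ≤ k → k + 1 ≤ matroidRank M M.E →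
        w (k - 1) * w (k + 1) ≤ (w k) ^ 2 := by
  set C := rankedClosureOfMatroid M hE hloopless with hC
  have hr : C.r C.ground = matroidRank M M.E := congrArg (matroidRank M) hE.coe_toFinset
  have hwk : ∀ k ≤ matroidRank M M.E, w k = C.whitney k := fun k hk => by
    have h := eq_of_sum_mul_pow_sub_eq (n := matroidRank M M.E)
      (a := fun k => (-1 : ℝ) ^ k * w k) (b := fun k => (-1 : ℝ) ^ k * C.whitney k)
      (fun x => by
        rw [← hw x, ← hr, ← C.sum_powerset_eq_sum_whitney x]
        rfl) hk
    exact mul_left_cancel₀ (pow_ne_zero k (by norm_num)) h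
  refine ⟨fun k hk => hwk k hk ▸ RankedClosure.whitney_nonneg k, fun k hk1 hk => ?_⟩
  obtain ⟨n, rfl⟩ := Nat.exists_eq_add_of_le' hk1
  rw [Nat.add_sub_cancel, hwk n (by omega), hwk _ hk, hwk (n + 1) (by omega)]
  exact RankedClosure.whitney_log_concave (by rw [hr]; exact hk)
end

section
/- (Welsh–Powell) Let G be a finite simple graph with vertices v_1, …, v_n listed in non-increasing order of degree, deg(v_1) ≥ deg(v_2) ≥ … ≥ deg(v_n). Then the chromatic number of G satisfies χ(G) ≤ max_{1 ≤ i ≤ n} min(deg(v_i) + 1, i). -/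
/-- Greedy colouring: if every vertex has fewer than `k` neighbours preceding it in the order
given by an injective ranking `f`, then the graph is `k`-colourable. -/
theorem SimpleGraph.colorable_of_card_preceding_neighbors_lt {V : Type*} [Fintype V]
    (G : SimpleGraph V) [DecidableRel G.Adj] {f : V → ℕ} (hf : Function.Injective f) {k : ℕ}
    (h : ∀ w, ((G.neighborFinset w).filter fun u => f u < f w).card < k) : G.Colorable k := by
  classical
  have key : ∀ m, ∃ c : V → ℕ, (∀ w, f w < m → c w < k) ∧
      ∀ u w, f u < f w → f w < m → G.Adj u w → c u ≠ c w := by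
    intro m
    induction m with
    | zero => exact ⟨fun _ => 0, by simp, by simp⟩
    | succ m ih =>
      obtain ⟨c, hck, hc⟩ := ih
      by_cases hx : ∃ x, f x = m
      · obtain ⟨x, rfl⟩ := hx
        obtain ⟨a, ha, hna⟩ := Finset.exists_mem_notMem_of_card_lt_card
          (s := ((G.neighborFinset x).filter fun u => f u < f x).image c) (t := Finset.range k)
          (by simpa using Finset.card_image_le.trans_lt (h x))
        have hlt : ∀ w, f w < f x + 1 → w ≠ x → f w < f x := fun w hw hwx =>
          lt_of_le_of_ne (Nat.lt_succ_iff.mp hw) (hf.ne hwx)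
        refine ⟨Function.update c x a, fun w hw => ?_, fun u w huw hw hadj => ?_⟩
        · by_cases hwx : w = x
          · simpa [hwx] using ha
          · simpa [hwx] using hck w (hlt w hw hwx)
        · have hux : u ≠ x := by rintro rfl; omega
          by_cases hwx : w = x
          · subst hwx
            simp only [Function.update_self, Function.update_of_ne hux]
            rintro rfl
            exact hna (Finset.mem_image_of_mem c (by simpa using ⟨hadj.symm, huw⟩))
          · simpa [hux, hwx] using hc u w huw (hlt w hw hwx) hadj
      · push Not at hx
        have hlt : ∀ w, f w < m + 1 → f w < m := fun w hw =>
          lt_of_le_of_ne (Nat.lt_succ_iff.mp hw) (hx w)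
        exact ⟨c, fun w hw => hck w (hlt w hw), fun u w huw hw => hc u w huw (hlt w hw)⟩
  obtain ⟨c, hck, hc⟩ := key (Finset.univ.sup f + 1)
  have hm : ∀ w, f w < Finset.univ.sup f + 1 := fun w =>
    Nat.lt_succ_of_le (Finset.le_sup (Finset.mem_univ w))
  refine ⟨SimpleGraph.Coloring.mk (fun w => ⟨c w, hck w (hm w)⟩) fun {u w} hadj heq => ?_⟩
  have heq' : c u = c w := congrArg Fin.val heq
  rcases lt_or_gt_of_ne (hf.ne hadj.ne) with huw | huw
  · exact hc u w huw (hm w) hadj heq'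
  · exact hc w u huw (hm u) hadj.symm heq'.symm

/-- **Welsh–Powell.** Let `G` be a finite simple graph whose vertices `v 1, …, v n` are
listed in non-increasing order of degree.  Then the chromatic number of `G` satisfies
`χ(G) ≤ max_{1 ≤ i ≤ n} min(deg(v i) + 1, i)`. -/
theorem welsh_powell {n : ℕ} (G : SimpleGraph (Fin n)) [DecidableRel G.Adj]
    (v : Fin n ≃ Fin n)
    (hv : ∀ i j : Fin n, i ≤ j → G.degree (v j) ≤ G.degree (v i)) :
    G.chromaticNumber ≤
      ((Finset.univ.sup fun i : Fin n => min (G.degree (v i) + 1) (i.val + 1) : ℕ) : ℕ∞) := by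
  refine (G.colorable_of_card_preceding_neighbors_lt (f := fun w => (v.symm w).val)
    (Fin.val_injective.comp v.symm.injective) fun w => ?_).chromaticNumber_le
  have hle := Finset.le_sup (f := fun i : Fin n => min (G.degree (v i) + 1) (i.val + 1))
    (Finset.mem_univ (v.symm w))
  refine lt_of_lt_of_le (lt_min ?_ ?_) hle
  · rw [Equiv.apply_symm_apply]
    exact Nat.lt_succ_of_le (Finset.card_filter_le _ _)
  · refine Nat.lt_succ_of_le ?_
    rw [← Finset.card_range (v.symm w).val]
    refine Finset.card_le_card_of_injOn (fun u => (v.symm u).val) (fun u hu => ?_)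
      (Fin.val_injective.comp v.symm.injective).injOn
    simpa using (Finset.mem_filter.mp hu).2
end

section
/- (Welsh, Euler's theorem for binary matroids) Let M be a binary matroid on a finite ground set E, i.e. a matroid representable over the two-element field GF(2). Then E can be partitioned into a disjoint union of circuits of M if and only if every cocircuit of M has even cardinality. -/
/-- `M` is a binary matroid: it is representable over the two-element field `GF(2)`, i.e.
there is a map `φ` from the ground set to a vector space over `GF(2)` such that a subset
`I` of the ground set is independent in `M` exactly when the family `φ` restricted to `I`
is linearly independent (equivalently, injective with linearly independent image). -/
def IsBinaryMatroid {α : Type*} (M : Matroid α) : Prop :=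
  ∃ (W : Type) (_ : AddCommGroup W) (_ : Module (ZMod 2) W) (φ : α → W),
    ∀ I : Set α, I ⊆ M.E →
      (M.Indep I ↔ LinearIndependent (ZMod 2) fun x : I => φ (x : α))

/-- `C` is a circuit of the matroid `M`: a minimal dependent subset of the ground set. -/
def IsMatroidCircuit {α : Type*} (M : Matroid α) (C : Set α) : Prop :=
  C ⊆ M.E ∧ ¬M.Indep C ∧ ∀ D : Set α, D ⊂ C → M.Indep D

namespace Matroid

variable {α : Type*} {M : Matroid α}

theorem isMatroidCircuit_iff_isCircuit {C : Set α} : IsMatroidCircuit M C ↔ M.IsCircuit C := by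
  rw [isCircuit_iff_forall_ssubset, IsMatroidCircuit, Matroid.Dep]
  tauto

/-- Every cocircuit is the fundamental cocircuit of one of its elements with respect to
some base. -/
theorem IsCocircuit.exists_eq_fundCocircuit {K : Set α} (hK : M.IsCocircuit K) :
    ∃ B b, M.IsBase B ∧ b ∈ B ∧ K = M.fundCocircuit b B := by
  obtain ⟨b, hb⟩ := hK.nonempty
  obtain ⟨B', hB', hsub⟩ := (hK.isCircuit.sdiff_singleton_indep hb).exists_isBase_superset
  have hbB' : b ∉ B' := fun h ↦ hK.isCircuit.not_indep <| hB'.indep.subset fun x hx ↦ by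
    by_cases hxb : x = b
    · exact hxb ▸ h
    · exact hsub ⟨hx, hxb⟩
  refine ⟨M.E \ B', b, hB'.compl_isBase_of_dual, ⟨hK.subset_ground hb, hbB'⟩, ?_⟩
  have hB'E : B' ⊆ M.E := hB'.subset_ground
  rw [fundCocircuit, dual_ground, Set.sdiff_sdiff_cancel_left hB'E]
  refine hK.isCircuit.eq_fundCircuit_of_subset hB'.indep fun x hx ↦ ?_
  by_cases hxb : x = b
  · exact .inl hxb
  · exact .inr (hsub ⟨hx, hxb⟩)

end Matroid

section ZModTwo

variable {α W : Type*} [AddCommGroup W] [Module (ZMod 2) W] {φ : α → W}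

theorem not_linearIndepOn_zmod_two_iff {X : Finset α} :
    ¬ LinearIndepOn (ZMod 2) φ (X : Set α) ↔ ∃ D ⊆ X, D.Nonempty ∧ ∑ x ∈ D, φ x = 0 := by
  classical
  rw [linearIndepOn_finset_iff]
  push Not
  constructor
  · rintro ⟨g, hg, i, hi, hgi⟩
    refine ⟨X.filter (g · ≠ 0), Finset.filter_subset _ _, ⟨i, by simp [hi, hgi]⟩, ?_⟩
    rw [← hg, Finset.sum_filter]
    refine Finset.sum_congr rfl fun x _ ↦ ?_
    by_cases hx : g x = 0
    · simp [hx]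
    · rw [if_pos hx, Fin.eq_one_of_ne_zero (g x) hx]
      exact (one_smul (ZMod 2) (φ x)).symm
  · rintro ⟨D, hDX, ⟨i, hi⟩, hD⟩
    refine ⟨fun x ↦ if x ∈ D then 1 else 0, ?_, i, hDX hi, by simp [hi]⟩
    simp only [ite_smul, one_smul, zero_smul]
    rw [← Finset.sum_filter, Finset.filter_mem_eq_inter, Finset.inter_eq_right.2 hDX, hD]

end ZModTwo

namespace Matroid

variable {α W : Type*} [AddCommGroup W] [Module (ZMod 2) W] {M : Matroid α} {φ : α → W}

theorem IsCircuit.sum_eq_zero {C : Finset α}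
    (hφ : ∀ I ⊆ M.E, (M.Indep I ↔ LinearIndepOn (ZMod 2) φ I)) (hC : M.IsCircuit (C : Set α)) :
    ∑ x ∈ C, φ x = 0 := by
  have hdep := hC.not_indep
  rw [hφ _ hC.subset_ground, not_linearIndepOn_zmod_two_iff] at hdep
  obtain ⟨D, hDC, hne, hD⟩ := hdep
  have hD' : ¬ M.Indep (D : Set α) := by
    rw [hφ _ ((Finset.coe_subset.2 hDC).trans hC.subset_ground), not_linearIndepOn_zmod_two_iff]
    exact ⟨D, subset_rfl, hne, hD⟩
  rwa [← Finset.coe_injective (hC.eq_of_not_indep_subset hD' (Finset.coe_subset.2 hDC))]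

/-- A set whose vectors sum to zero is a disjoint union of circuits. -/
theorem exists_isCircuit_partition_of_sum_eq_zero
    (hφ : ∀ I ⊆ M.E, (M.Indep I ↔ LinearIndepOn (ZMod 2) φ I)) (X : Finset α)
    (hXE : (X : Set α) ⊆ M.E) (hX : ∑ x ∈ X, φ x = 0) :
    ∃ 𝒞 : Set (Set α), (∀ C ∈ 𝒞, M.IsCircuit C) ∧ 𝒞.PairwiseDisjoint id ∧ ⋃₀ 𝒞 = X := by
  classical
  induction X using Finset.strongInduction with
  | H X ih =>
  obtain rfl | hne := X.eq_empty_or_nonempty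
  · exact ⟨∅, by simp⟩
  have hdep : M.Dep (X : Set α) := by
    refine ⟨?_, hXE⟩
    rw [hφ _ hXE, not_linearIndepOn_zmod_two_iff]
    exact ⟨X, subset_rfl, hne, hX⟩
  obtain ⟨C, hCX, hC⟩ := hdep.exists_isCircuit_subset
  lift C to Finset α using X.finite_toSet.subset hCX
  have hCX' : C ⊆ X := Finset.coe_subset.1 hCX
  have hsum : ∑ x ∈ X \ C, φ x = 0 := by
    have h := Finset.sum_sdiff (f := φ) hCX'
    rwa [hC.sum_eq_zero hφ, add_zero, hX] at h
  obtain ⟨𝒞, h𝒞, hdj, hU⟩ := ih (X \ C)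
    (Finset.sdiff_ssubset hCX' (Finset.coe_nonempty.1 hC.nonempty))
    ((Finset.coe_subset.2 Finset.sdiff_subset).trans hXE) hsum
  refine ⟨insert (C : Set α) 𝒞, ?_, hdj.insert fun D hD _ ↦ ?_, ?_⟩
  · rintro D (rfl | hD)
    exacts [hC, h𝒞 D hD]
  · have hDX : D ⊆ ((X \ C : Finset α) : Set α) := hU ▸ Set.subset_sUnion_of_mem hD
    rw [Finset.coe_sdiff] at hDX
    exact Set.disjoint_of_subset_right hDX Set.disjoint_sdiff_right
  · rw [Set.sUnion_insert, hU, Finset.coe_sdiff, Set.union_sdiff_cancel hCX]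

/-- A disjoint union of circuits has vectors summing to zero. -/
theorem sum_eq_zero_of_isCircuit_partition
    (hφ : ∀ I ⊆ M.E, (M.Indep I ↔ LinearIndepOn (ZMod 2) φ I)) (X : Finset α)
    {𝒞 : Set (Set α)} (h𝒞 : ∀ C ∈ 𝒞, M.IsCircuit C) (hdj : 𝒞.PairwiseDisjoint id)
    (hU : ⋃₀ 𝒞 = X) : ∑ x ∈ X, φ x = 0 := by
  have hfin : (⋃₀ 𝒞).Finite := hU ▸ X.finite_toSet
  rw [← finsum_mem_coe_finset, ← hU, finsum_mem_sUnion hdj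
    (hfin.finite_subsets.subset fun _ hC ↦ Set.subset_sUnion_of_mem hC)
    fun C hC ↦ hfin.subset (Set.subset_sUnion_of_mem hC)]
  refine finsum_mem_eq_zero_of_forall_eq_zero fun C hC ↦ ?_
  have hCircuit := h𝒞 C hC
  lift C to Finset α using hfin.subset (Set.subset_sUnion_of_mem hC)
  rw [finsum_mem_coe_finset, hCircuit.sum_eq_zero hφ]

open scoped Classical in
/-- The expansion of a vector in terms of a base is given by the fundamental cocircuits. -/
theorem IsBase.eq_sum_fundCocircuit {B : Finset α}
    (hφ : ∀ I ⊆ M.E, (M.Indep I ↔ LinearIndepOn (ZMod 2) φ I)) (hB : M.IsBase (B : Set α))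
    {e : α} (he : e ∈ M.E) :
    φ e = ∑ b ∈ B, if e ∈ M.fundCocircuit b B then φ b else 0 := by
  by_cases heB : e ∈ B
  · rw [Finset.sum_eq_single_of_mem e heB, if_pos (mem_fundCocircuit ..)]
    refine fun b hb hbe ↦ if_neg fun hmem ↦ hbe ?_
    have h : e ∈ M.fundCocircuit b B ∩ B := ⟨hmem, heB⟩
    rw [fundCocircuit_inter_eq M (Finset.mem_coe.2 hb)] at h
    exact h.symm
  have hC := hB.fundCircuit_isCircuit he heB
  have hsub := M.fundCircuit_subset_insert e B
  obtain ⟨C, hCeq⟩ : ∃ C : Finset α, (C : Set α) = M.fundCircuit e B :=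
    ⟨_, ((B.finite_toSet.insert e).subset hsub).coe_toFinset⟩
  have hmem : ∀ x, x ∈ M.fundCircuit e B ↔ x ∈ C := fun x ↦ by rw [← hCeq, Finset.mem_coe]
  rw [← hCeq] at hC
  have heC : e ∈ C := (hmem e).1 (M.mem_fundCircuit e B)
  have hsum := hC.sum_eq_zero hφ
  rw [← Finset.add_sum_erase _ _ heC, ← ZModModule.sub_eq_add, sub_eq_zero] at hsum
  rw [hsum, ← Finset.sum_filter]
  refine Finset.sum_congr (Finset.ext fun x ↦ ?_) fun _ _ ↦ rfl
  rw [Finset.mem_filter, Finset.mem_erase, hB.mem_fundCocircuit_iff_mem_fundCircuit, hmem]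
  refine ⟨fun ⟨hxe, hx⟩ ↦ ⟨?_, hx⟩, fun ⟨hxB, hx⟩ ↦ ⟨fun h ↦ heB (h ▸ hxB), hx⟩⟩
  exact (hsub ((hmem x).2 hx)).resolve_left hxe

/-- The coordinates of the sum of all vectors are the parities of the fundamental cocircuits. -/
theorem IsBase.sum_ground_eq {B X : Finset α}
    (hφ : ∀ I ⊆ M.E, (M.Indep I ↔ LinearIndepOn (ZMod 2) φ I)) (hB : M.IsBase (B : Set α))
    (hX : (X : Set α) = M.E) :
    ∑ x ∈ X, φ x = ∑ b ∈ B, ((M.fundCocircuit b B).ncard : ZMod 2) • φ b := by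
  classical
  have hmem : ∀ x ∈ X, x ∈ M.E := fun x hx ↦ hX ▸ Finset.mem_coe.2 hx
  rw [Finset.sum_congr rfl fun x hx ↦ hB.eq_sum_fundCocircuit hφ (hmem x hx), Finset.sum_comm]
  refine Finset.sum_congr rfl fun b hb ↦ ?_
  have hK : M.fundCocircuit b B = X.filter (· ∈ M.fundCocircuit b B) := by
    rw [Finset.coe_filter]
    ext x
    refine ⟨fun hx ↦ ⟨?_, hx⟩, fun hx ↦ hx.2⟩
    rw [← Finset.mem_coe, hX]
    exact (fundCocircuit_isCocircuit (Finset.mem_coe.2 hb) hB).subset_ground hx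
  rw [← Finset.sum_filter, Finset.sum_const]
  conv_rhs => rw [hK, Set.ncard_coe_finset]
  rw [Nat.cast_smul_eq_nsmul]

/-- The vectors of a binary representation sum to zero iff all cocircuits are even. -/
theorem sum_ground_eq_zero_iff_forall_isCocircuit_even {X : Finset α}
    (hφ : ∀ I ⊆ M.E, (M.Indep I ↔ LinearIndepOn (ZMod 2) φ I)) (hX : (X : Set α) = M.E) :
    ∑ x ∈ X, φ x = 0 ↔ ∀ K, M.IsCocircuit K → Even K.ncard := by
  have hfin : M.E.Finite := hX ▸ X.finite_toSet
  constructor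
  · intro hsum K hK
    obtain ⟨B, b, hB, hb, rfl⟩ := hK.exists_eq_fundCocircuit
    lift B to Finset α using hfin.subset hB.subset_ground
    rw [hB.sum_ground_eq hφ hX] at hsum
    rw [← ZMod.natCast_eq_zero_iff_even]
    exact linearIndepOn_finset_iff.1 ((hφ _ hB.subset_ground).1 hB.indep) _ hsum b hb
  · intro h
    obtain ⟨B, hB⟩ := M.exists_isBase
    lift B to Finset α using hfin.subset hB.subset_ground
    rw [hB.sum_ground_eq hφ hX]
    refine Finset.sum_eq_zero fun b hb ↦ ?_
    rw [ZMod.natCast_eq_zero_iff_even.2 (h _ (fundCocircuit_isCocircuit (Finset.mem_coe.2 hb) hB)),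
      zero_smul]

end Matroid

/-- **Welsh** (Euler's theorem for binary matroids).  Let `M` be a binary matroid on a
finite ground set `E`.  Then `E` can be partitioned into a disjoint union of circuits of
`M` if and only if every cocircuit of `M` (circuit of the dual `M✶`) has even
cardinality. -/
theorem binary_matroid_euler {α : Type*} (M : Matroid α) (hE : M.E.Finite)
    (hbin : IsBinaryMatroid M) :
    (∃ 𝒞 : Set (Set α), (∀ C ∈ 𝒞, IsMatroidCircuit M C) ∧
        𝒞.PairwiseDisjoint id ∧ ⋃₀ 𝒞 = M.E) ↔
      ∀ K : Set α, IsMatroidCircuit M✶ K → Even K.ncard := by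
  obtain ⟨W, _, _, φ, hφ⟩ := hbin
  have hX : (hE.toFinset : Set α) = M.E := hE.coe_toFinset
  simp only [Matroid.isMatroidCircuit_iff_isCircuit]
  rw [← Matroid.sum_ground_eq_zero_iff_forall_isCocircuit_even hφ hX]
  refine ⟨fun ⟨_, h𝒞, hdj, hU⟩ ↦
    Matroid.sum_eq_zero_of_isCircuit_partition hφ _ h𝒞 hdj (hU.trans hX.symm), fun h ↦ ?_⟩
  obtain ⟨𝒞, h𝒞, hdj, hU⟩ :=
    Matroid.exists_isCircuit_partition_of_sum_eq_zero hφ _ hX.subset h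
  exact ⟨𝒞, h𝒞, hdj, hU.trans hX⟩
end
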